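/- For every R₁ > 0 there exist real numbers a(R₁) and b(R₁) with R₁ < a(R₁) < b(R₁) such that the double inequality λ₁(B_{R₁}) < λ₁(M_{R₁,R₂}) < λ₂(B_{R₁}) holds if and only if R₂ ∈ (a(R₁), b(R₁)). -/

import Mathlib

open MeasureTheory Real Set

noncomputable section

/-- A Dirichlet test function on `ω`: smooth, compactly supported, with support in `ω`. -/
def testFun (ω : Set (ℝ × ℝ)) (u : (ℝ × ℝ) → ℝ) : Prop :=
  ContDiff ℝ (⊤ : ℕ∞) u ∧ HasCompactSupport u ∧ tsupport u ⊆ ω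

/-- `|∇u|²` at a point. -/
def gradSq (u : (ℝ × ℝ) → ℝ) (x : ℝ × ℝ) : ℝ :=
  fderiv ℝ u x (1, 0) ^ 2 + fderiv ℝ u x (0, 1) ^ 2

/-- The Rayleigh quotient of `u` on `ω`. -/
def rayleigh (ω : Set (ℝ × ℝ)) (u : (ℝ × ℝ) → ℝ) : ℝ :=
  (∫ x in ω, gradSq u x) / ∫ x in ω, u x ^ 2

/-- The `k`-th Dirichlet eigenvalue of `ω` (`k ≥ 1`), via the Courant–Fischer
min-max formula over `k`-dimensional subspaces of `C_c^∞(ω)`. -/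
def dirichletEV (ω : Set (ℝ × ℝ)) (k : ℕ) : ℝ :=
  sInf {l | ∃ V : Submodule ℝ ((ℝ × ℝ) → ℝ),
    (V : Set ((ℝ × ℝ) → ℝ)) ⊆ {u | testFun ω u} ∧ Module.finrank ℝ V = k ∧
    l = sSup {r | ∃ u ∈ V, u ≠ 0 ∧ r = rayleigh ω u}}

/-- The open disk `B_R` centered at the origin. -/
def disk (R : ℝ) : Set (ℝ × ℝ) := {x | x.1 ^ 2 + x.2 ^ 2 < R ^ 2}

/-- The open annulus `M_{R₁,R₂} = B_{R₂} \ closure (B_{R₁})`. -/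
def annulus (R₁ R₂ : ℝ) : Set (ℝ × ℝ) := disk R₂ \ closure (disk R₁)

/-- `D_{R₁,R₂} = B_{R₁} ∪ M_{R₁,R₂}`. -/
def diskUnionAnnulus (R₁ R₂ : ℝ) : Set (ℝ × ℝ) := disk R₁ ∪ annulus R₁ R₂

/-- The cracked domain `𝔇(N,ε)`. -/
def crackedDomain (R₁ R₂ : ℝ) (N : ℕ) (ε : ℝ) : Set (ℝ × ℝ) :=
  diskUnionAnnulus R₁ R₂ ∪
    ⋃ j ∈ Finset.range N, {x | ∃ θ : ℝ, θ ∈ Set.Ioo (2 * π * j / N - ε) (2 * π * j / N + ε) ∧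
      x = (R₁ * Real.cos θ, R₁ * Real.sin θ)}

section OneDimensional

/-- Cauchy–Schwarz against the constant function. -/
theorem sq_integral_le {f : ℝ → ℝ} (hf : Continuous f) {a b : ℝ} (hab : a ≤ b) :
    (∫ x in a..b, f x) ^ 2 ≤ (b - a) * ∫ x in a..b, f x ^ 2 := by
  set m := ∫ x in a..b, f x with hm
  have h0 : 0 ≤ ∫ x in a..b, ((b - a) * f x - m) ^ 2 :=
    intervalIntegral.integral_nonneg hab fun x _ => sq_nonneg _
  have h1 : ∫ x in a..b, ((b - a) * f x - m) ^ 2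
      = (b - a) * ((b - a) * (∫ x in a..b, f x ^ 2) - m ^ 2) := by
    have : ∀ x, ((b - a) * f x - m) ^ 2
        = (b - a) ^ 2 * f x ^ 2 - 2 * (b - a) * m * f x + m ^ 2 := fun x => by ring
    simp_rw [this]
    rw [intervalIntegral.integral_add, intervalIntegral.integral_sub,
      intervalIntegral.integral_const_mul, intervalIntegral.integral_const_mul,
      intervalIntegral.integral_const, ← hm]
    · simp only [smul_eq_mul]; ring
    all_goals exact Continuous.intervalIntegrable (by fun_prop) _ _
  rcases hab.eq_or_lt with rfl | hlt
  · simp [hm]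
  · rw [h1] at h0
    have := nonneg_of_mul_nonneg_right h0 (sub_pos.2 hlt)
    linarith

/-- Poincaré inequality for functions vanishing at the left endpoint. -/
theorem poincare_left {f f' : ℝ → ℝ} (hf : ∀ x, HasDerivAt f (f' x) x) (hf' : Continuous f')
    {a b : ℝ} (hab : a ≤ b) (ha : f a = 0) :
    ∫ x in a..b, f x ^ 2 ≤ (b - a) ^ 2 / 2 * ∫ x in a..b, f' x ^ 2 := by
  have hc : Continuous f := continuous_iff_continuousAt.2 fun x => (hf x).continuousAt
  have key : ∀ x ∈ Icc a b, f x ^ 2 ≤ (x - a) * ∫ x in a..b, f' x ^ 2 := by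
    intro x hx
    have h1 : f x = ∫ t in a..x, f' t := by
      rw [intervalIntegral.integral_eq_sub_of_hasDerivAt (fun t _ => hf t)
        (hf'.intervalIntegrable _ _), ha, sub_zero]
    rw [h1]
    refine (sq_integral_le hf' hx.1).trans (mul_le_mul_of_nonneg_left ?_ (sub_nonneg.2 hx.1))
    exact intervalIntegral.integral_mono_interval le_rfl hx.1 hx.2
      (Filter.Eventually.of_forall fun t => sq_nonneg _)
      ((hf'.pow 2).intervalIntegrable _ _)
  calc ∫ x in a..b, f x ^ 2 ≤ ∫ x in a..b, (x - a) * ∫ x in a..b, f' x ^ 2 :=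
        intervalIntegral.integral_mono_on hab ((hc.pow 2).intervalIntegrable _ _)
          (Continuous.intervalIntegrable (by fun_prop) _ _) key
    _ = (b - a) ^ 2 / 2 * ∫ x in a..b, f' x ^ 2 := by
        rw [intervalIntegral.integral_mul_const]
        congr 1
        rw [intervalIntegral.integral_sub (Continuous.intervalIntegrable (by fun_prop) _ _)
          (Continuous.intervalIntegrable (by fun_prop) _ _), integral_id,
          intervalIntegral.integral_const]
        simp only [smul_eq_mul]; ring

/-- Poincaré inequality for functions vanishing at the right endpoint. -/
theorem poincare_right {f f' : ℝ → ℝ} (hf : ∀ x, HasDerivAt f (f' x) x) (hf' : Continuous f')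
    {a b : ℝ} (hab : a ≤ b) (hb : f b = 0) :
    ∫ x in a..b, f x ^ 2 ≤ (b - a) ^ 2 / 2 * ∫ x in a..b, f' x ^ 2 := by
  have h := poincare_left (f := fun x => f (-x)) (f' := fun x => -f' (-x)) (a := -b) (b := -a)
    (fun x => by simpa [Function.comp_def] using (hf (-x)).comp x (hasDerivAt_neg x))
    (by fun_prop) (by linarith)
    (by simpa using hb)
  simp only [even_two, Even.neg_pow] at h
  rw [intervalIntegral.integral_comp_neg (fun x => f x ^ 2),
    intervalIntegral.integral_comp_neg (fun x => f' x ^ 2)] at h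
  simp only [neg_neg] at h
  convert h using 2
  ring

/-- Poincaré inequality for functions vanishing at both endpoints. -/
theorem poincare_dirichlet {f f' : ℝ → ℝ} (hf : ∀ x, HasDerivAt f (f' x) x)
    (hf' : Continuous f') {a b : ℝ} (hab : a ≤ b) (ha : f a = 0) (hb : f b = 0) :
    ∫ x in a..b, f x ^ 2 ≤ (b - a) ^ 2 / 8 * ∫ x in a..b, f' x ^ 2 := by
  have hc : Continuous f := continuous_iff_continuousAt.2 fun x => (hf x).continuousAt
  have h1 := poincare_left hf hf' (a := a) (b := (a + b) / 2) (by linarith) ha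
  have h2 := poincare_right hf hf' (a := (a + b) / 2) (b := b) (by linarith) hb
  rw [← intervalIntegral.integral_add_adjacent_intervals (f := fun x => f x ^ 2) (b := (a + b) / 2)
    ((hc.pow 2).intervalIntegrable _ _) ((hc.pow 2).intervalIntegrable _ _),
    ← intervalIntegral.integral_add_adjacent_intervals (f := fun x => f' x ^ 2) (b := (a + b) / 2)
    ((hf'.pow 2).intervalIntegrable _ _) ((hf'.pow 2).intervalIntegrable _ _)]
  ring_nf at h1 h2 ⊢
  linarith

/-- Wirtinger inequality for functions with zero mean. -/
theorem wirtinger_of_integral_eq_zero {f f' : ℝ → ℝ} (hf : ∀ x, HasDerivAt f (f' x) x)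
    (hf' : Continuous f') {a b : ℝ} (hab : a ≤ b) (h0 : ∫ x in a..b, f x = 0) :
    ∫ x in a..b, f x ^ 2 ≤ (b - a) ^ 2 / 8 * ∫ x in a..b, f' x ^ 2 := by
  have hc : Continuous f := continuous_iff_continuousAt.2 fun x => (hf x).continuousAt
  set G : ℝ → ℝ := fun x => ∫ t in a..x, f t with hG
  have hGd : ∀ x, HasDerivAt G (f x) x := fun x =>
    intervalIntegral.integral_hasDerivAt_right (hc.intervalIntegrable _ _)
      (hc.stronglyMeasurableAtFilter _ _) hc.continuousAt
  have hGc : Continuous G := continuous_iff_continuousAt.2 fun x => (hGd x).continuousAt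
  have hGa : G a = 0 := by simp [hG]
  have hGb : G b = 0 := h0
  have hp := poincare_dirichlet hGd hc hab hGa hGb
  have hparts : ∫ x in a..b, f x ^ 2 = - ∫ x in a..b, G x * f' x := by
    have := intervalIntegral.integral_mul_deriv_eq_deriv_mul (a := a) (b := b)
      (fun x _ => hGd x) (fun x _ => hf x)
      (hc.intervalIntegrable _ _) (hf'.intervalIntegrable _ _)
    rw [this, hGa, hGb]
    simp [sq]
  set A := ∫ x in a..b, f x ^ 2
  set B := ∫ x in a..b, f' x ^ 2
  set C := ∫ x in a..b, G x ^ 2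
  set c := (b - a) ^ 2 / 8 with hcdef
  have hcross : 2 * A ≤ C * c⁻¹ + c * B := by
    rcases hab.eq_or_lt with rfl | hlt
    · simp [A, B, C]
    have hcpos : 0 < c := by
      have := sub_pos.2 hlt
      positivity
    have h : 0 ≤ ∫ x in a..b, (c⁻¹ * (G x + c * f' x) ^ 2) :=
      intervalIntegral.integral_nonneg hab fun x _ => by positivity
    have h2 : ∀ x, c⁻¹ * (G x + c * f' x) ^ 2
        = c⁻¹ * G x ^ 2 + 2 * (G x * f' x) + c * f' x ^ 2 := fun x => by field_simp; ring
    simp_rw [h2] at h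
    rw [intervalIntegral.integral_add, intervalIntegral.integral_add,
      intervalIntegral.integral_const_mul, intervalIntegral.integral_const_mul,
      intervalIntegral.integral_const_mul] at h
    · rw [mul_comm C]; linarith
    all_goals exact Continuous.intervalIntegrable (by fun_prop) _ _
  rcases hab.eq_or_lt with rfl | hlt
  · simp [A, B]
  have hcpos : 0 < c := by
    have := sub_pos.2 hlt
    positivity
  have : C * c⁻¹ ≤ A := by
    rw [mul_inv_le_iff₀ hcpos]; linarith
  linarith

theorem wirtinger {f f' : ℝ → ℝ} (hf : ∀ x, HasDerivAt f (f' x) x)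
    (hf' : Continuous f') {a b : ℝ} (hab : a < b) :
    (∫ x in a..b, f x ^ 2) - (∫ x in a..b, f x) ^ 2 / (b - a)
      ≤ (b - a) ^ 2 / 8 * ∫ x in a..b, f' x ^ 2 := by
  have hc : Continuous f := continuous_iff_continuousAt.2 fun x => (hf x).continuousAt
  have hba := sub_pos.2 hab
  set m := (∫ x in a..b, f x) / (b - a) with hm
  have hmI : ∫ x in a..b, f x = m * (b - a) := by rw [hm]; field_simp
  have h := wirtinger_of_integral_eq_zero (f := fun x => f x - m) (fun x => (hf x).sub_const m)
    hf' hab.le (by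
      rw [intervalIntegral.integral_sub (hc.intervalIntegrable _ _)
        (continuous_const.intervalIntegrable _ _), intervalIntegral.integral_const, hmI]
      simp only [smul_eq_mul]; ring)
  refine le_trans (le_of_eq ?_) h
  have : ∀ x, (f x - m) ^ 2 = f x ^ 2 - 2 * m * f x + m ^ 2 := fun x => by ring
  simp_rw [this]
  rw [intervalIntegral.integral_add, intervalIntegral.integral_sub,
      intervalIntegral.integral_const_mul, intervalIntegral.integral_const, hmI]
  · simp only [smul_eq_mul]; field_simp; ring
  all_goals exact Continuous.intervalIntegrable (by fun_prop) _ _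

/-- Second-eigenvalue type inequality on `(-R, R)`: the loss is the mean over the middle half. -/
theorem poincare_with_mean {f f' : ℝ → ℝ} (hf : ∀ x, HasDerivAt f (f' x) x)
    (hf' : Continuous f') {R : ℝ} (hR : 0 < R) (hl : f (-R) = 0) (hr : f R = 0) :
    (∫ x in -R..R, f x ^ 2) - (∫ x in -(R / 2)..R / 2, f x) ^ 2 / R
      ≤ R ^ 2 / 8 * ∫ x in -R..R, f' x ^ 2 := by
  have hc : Continuous f := continuous_iff_continuousAt.2 fun x => (hf x).continuousAt
  have h1 := poincare_left hf hf' (a := -R) (b := -(R / 2)) (by linarith) hl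
  have h2 := wirtinger hf hf' (a := -(R / 2)) (b := R / 2) (by linarith)
  have h3 := poincare_right hf hf' (a := R / 2) (b := R) (by linarith) hr
  have split : ∀ g : ℝ → ℝ, Continuous g → ∫ x in -R..R, g x =
      (∫ x in -R..-(R / 2), g x) + (∫ x in -(R / 2)..R / 2, g x) + ∫ x in R / 2..R, g x := by
    intro g hg
    rw [intervalIntegral.integral_add_adjacent_intervals (hg.intervalIntegrable _ _)
      (hg.intervalIntegrable _ _), intervalIntegral.integral_add_adjacent_intervals
      (hg.intervalIntegrable _ _) (hg.intervalIntegrable _ _)]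
  rw [split (fun x => f x ^ 2) (hc.pow 2), split (fun x => f' x ^ 2) (hf'.pow 2)]
  have e1 : (-(R / 2) - -R) ^ 2 / 2 = R ^ 2 / 8 := by ring
  have e2 : R / 2 - -(R / 2) = R := by ring
  have e3 : (R - R / 2) ^ 2 / 2 = R ^ 2 / 8 := by ring
  rw [e1] at h1
  rw [e2] at h2
  rw [e3] at h3
  linarith

end OneDimensional

section TestFunctions

variable {ω ω' : Set (ℝ × ℝ)} {u v : ℝ × ℝ → ℝ}

theorem testFun.mono (h : testFun ω u) (hω : ω ⊆ ω') : testFun ω' u :=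
  ⟨h.1, h.2.1, h.2.2.trans hω⟩

theorem testFun.continuous (h : testFun ω u) : Continuous u := h.1.continuous

theorem testFun.differentiable (h : testFun ω u) : Differentiable ℝ u :=
  h.1.differentiable (by simp)

theorem testFun.continuous_fderiv (h : testFun ω u) : Continuous (fderiv ℝ u) :=
  h.1.continuous_fderiv (by simp)

theorem testFun.continuous_gradSq (h : testFun ω u) : Continuous (gradSq u) :=
  ((h.continuous_fderiv.clm_apply continuous_const).pow 2).add
    ((h.continuous_fderiv.clm_apply continuous_const).pow 2)

theorem gradSq_nonneg (u : ℝ × ℝ → ℝ) (x : ℝ × ℝ) : 0 ≤ gradSq u x := by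
  unfold gradSq; positivity

theorem fderiv_eq_zero_of_notMem_tsupport {x : ℝ × ℝ} (hx : x ∉ tsupport u) :
    fderiv ℝ u x = 0 :=
  image_eq_zero_of_notMem_tsupport fun h => hx (tsupport_fderiv_subset ℝ h)

theorem gradSq_eq_zero_of_notMem_tsupport {x : ℝ × ℝ} (hx : x ∉ tsupport u) :
    gradSq u x = 0 := by
  simp [gradSq, fderiv_eq_zero_of_notMem_tsupport hx]

theorem testFun.eq_zero (h : testFun ω u) {x : ℝ × ℝ} (hx : x ∉ ω) : u x = 0 :=
  image_eq_zero_of_notMem_tsupport fun h' => hx (h.2.2 h')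

theorem testFun.fderiv_eq_zero (h : testFun ω u) {x : ℝ × ℝ} (hx : x ∉ ω) :
    fderiv ℝ u x = 0 :=
  fderiv_eq_zero_of_notMem_tsupport fun h' => hx (h.2.2 h')

theorem testFun.gradSq_eq_zero (h : testFun ω u) {x : ℝ × ℝ} (hx : x ∉ ω) : gradSq u x = 0 :=
  gradSq_eq_zero_of_notMem_tsupport fun h' => hx (h.2.2 h')

theorem testFun.hasCompactSupport_gradSq (h : testFun ω u) : HasCompactSupport (gradSq u) :=
  HasCompactSupport.intro h.2.1 fun _ hx => gradSq_eq_zero_of_notMem_tsupport hx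

theorem testFun.hasCompactSupport_sq (h : testFun ω u) : HasCompactSupport fun x => u x ^ 2 :=
  HasCompactSupport.intro h.2.1 fun x hx => by simp [image_eq_zero_of_notMem_tsupport hx]

theorem testFun.integrable_gradSq (h : testFun ω u) : Integrable (gradSq u) :=
  h.continuous_gradSq.integrable_of_hasCompactSupport h.hasCompactSupport_gradSq

theorem testFun.integrable_sq (h : testFun ω u) : Integrable fun x => u x ^ 2 :=
  (h.continuous.pow 2).integrable_of_hasCompactSupport h.hasCompactSupport_sq

theorem testFun.rayleigh_eq (h : testFun ω u) :
    rayleigh ω u = (∫ x, gradSq u x) / ∫ x, u x ^ 2 := by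
  unfold rayleigh
  rw [setIntegral_eq_integral_of_forall_compl_eq_zero fun x hx => h.gradSq_eq_zero hx,
    setIntegral_eq_integral_of_forall_compl_eq_zero fun x hx => by simp [h.eq_zero hx]]

theorem rayleigh_nonneg (ω : Set (ℝ × ℝ)) (u : ℝ × ℝ → ℝ) : 0 ≤ rayleigh ω u :=
  div_nonneg (integral_nonneg fun x => gradSq_nonneg u x) (integral_nonneg fun _ => sq_nonneg _)

theorem testFun.integral_sq_pos (h : testFun ω u) (hu : u ≠ 0) : 0 < ∫ x, u x ^ 2 := by
  obtain ⟨x, hx⟩ := Function.ne_iff.1 hu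
  exact (h.continuous.pow 2).integral_pos_of_hasCompactSupport_nonneg_nonzero
    h.hasCompactSupport_sq (fun _ => sq_nonneg _) (x := x) (pow_ne_zero 2 hx)

theorem testFun.const_smul (h : testFun ω u) (c : ℝ) : testFun ω (c • u) :=
  ⟨h.1.const_smul c, h.2.1.smul_left (f := fun _ => c),
    (tsupport_smul_subset_right (fun _ => c) u).trans h.2.2⟩

theorem testFun.add (h : testFun ω u) (h' : testFun ω v) : testFun ω (u + v) :=
  ⟨h.1.add h'.1, h.2.1.add h'.2.1, (tsupport_add u v).trans (union_subset h.2.2 h'.2.2)⟩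

theorem gradSq_const_smul (c : ℝ) (u : ℝ × ℝ → ℝ) (x : ℝ × ℝ) :
    gradSq (c • u) x = c ^ 2 * gradSq u x := by
  simp only [gradSq, fderiv_const_smul_field c, smul_apply, smul_eq_mul,
    Pi.smul_apply]
  ring

theorem rayleigh_const_smul {c : ℝ} (hc : c ≠ 0) (ω : Set (ℝ × ℝ)) (u : ℝ × ℝ → ℝ) :
    rayleigh ω (c • u) = rayleigh ω u := by
  simp only [rayleigh, gradSq_const_smul, Pi.smul_apply, smul_eq_mul, mul_pow,
    integral_const_mul]
  exact mul_div_mul_left _ _ (pow_ne_zero 2 hc)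

theorem exists_testFun_eq_one (hω : IsOpen ω) {p : ℝ × ℝ} (hp : p ∈ ω) :
    ∃ u, testFun ω u ∧ u p = 1 := by
  obtain ⟨f, hf, hfc, hfd, -, hfp⟩ :=
    exists_contDiff_tsupport_subset (n := ⊤) (hω.mem_nhds hp)
  exact ⟨f, ⟨hfd, hfc, hf⟩, hfp⟩

end TestFunctions

section Eigenvalues

variable {ω : Set (ℝ × ℝ)} {u : ℝ × ℝ → ℝ}

/-- The candidates for the `k`-th eigenvalue in the min-max formula. -/
def minMaxSet (ω : Set (ℝ × ℝ)) (k : ℕ) : Set ℝ :=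
  {l | ∃ V : Submodule ℝ ((ℝ × ℝ) → ℝ),
    (V : Set ((ℝ × ℝ) → ℝ)) ⊆ {u | testFun ω u} ∧ Module.finrank ℝ V = k ∧
    l = sSup {r | ∃ u ∈ V, u ≠ 0 ∧ r = rayleigh ω u}}

theorem nonneg_of_mem_minMaxSet {k : ℕ} {l : ℝ} (hl : l ∈ minMaxSet ω k) : 0 ≤ l := by
  obtain ⟨V, -, -, rfl⟩ := hl
  apply Real.sSup_nonneg
  rintro r ⟨u, -, -, rfl⟩
  exact rayleigh_nonneg ω u

theorem dirichletEV_nonneg (ω : Set (ℝ × ℝ)) (k : ℕ) : 0 ≤ dirichletEV ω k :=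
  Real.sInf_nonneg fun _ hl => nonneg_of_mem_minMaxSet hl

theorem rayleigh_mem_minMaxSet_one (h : testFun ω u) (hu : u ≠ 0) :
    rayleigh ω u ∈ minMaxSet ω 1 := by
  refine ⟨Submodule.span ℝ {u}, ?_, finrank_span_singleton hu, ?_⟩
  · intro w hw
    obtain ⟨c, rfl⟩ := Submodule.mem_span_singleton.1 hw
    exact h.const_smul c
  · have : {r | ∃ w ∈ Submodule.span ℝ {u}, w ≠ 0 ∧ r = rayleigh ω w} = {rayleigh ω u} := by
      ext r
      constructor
      · rintro ⟨w, hw, hw0, rfl⟩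
        obtain ⟨c, rfl⟩ := Submodule.mem_span_singleton.1 hw
        have hc : c ≠ 0 := by rintro rfl; simp at hw0
        exact rayleigh_const_smul hc ω u
      · rintro rfl
        exact ⟨u, Submodule.mem_span_singleton_self u, hu, rfl⟩
    rw [this, csSup_singleton]

theorem dirichletEV_one_le (h : testFun ω u) (hu : u ≠ 0) :
    dirichletEV ω 1 ≤ rayleigh ω u :=
  csInf_le ⟨0, fun _ hl => nonneg_of_mem_minMaxSet hl⟩ (rayleigh_mem_minMaxSet_one h hu)

theorem dirichletEV_one_mul_le (h : testFun ω u) :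
    dirichletEV ω 1 * ∫ x, u x ^ 2 ≤ ∫ x, gradSq u x := by
  by_cases hu : u = 0
  · subst hu
    simpa using integral_nonneg (gradSq_nonneg 0)
  · have := dirichletEV_one_le h hu
    rwa [h.rayleigh_eq, le_div_iff₀ (h.integral_sq_pos hu)] at this

theorem le_dirichletEV_one (hω : IsOpen ω) (hne : ω.Nonempty) {c : ℝ}
    (hc : ∀ u, testFun ω u → c * ∫ x, u x ^ 2 ≤ ∫ x, gradSq u x) :
    c ≤ dirichletEV ω 1 := by
  obtain ⟨p, hp⟩ := hne
  obtain ⟨f, hf, hfp⟩ := exists_testFun_eq_one hω hp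
  have hf0 : f ≠ 0 := by rintro rfl; simp at hfp
  refine le_csInf ⟨_, rayleigh_mem_minMaxSet_one hf hf0⟩ ?_
  rintro l ⟨V, hV, hdim, rfl⟩
  obtain ⟨w, hw, hspan⟩ := finrank_eq_one_iff'.1 hdim
  have hw0 : (w : ℝ × ℝ → ℝ) ≠ 0 := by simpa using hw
  have hset : {r | ∃ u ∈ V, u ≠ 0 ∧ r = rayleigh ω u} = {rayleigh ω w} := by
    ext r
    constructor
    · rintro ⟨z, hz, hz0, rfl⟩
      obtain ⟨a, ha⟩ := hspan ⟨z, hz⟩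
      have ha' : a • (w : ℝ × ℝ → ℝ) = z := congrArg Subtype.val ha
      have ha0 : a ≠ 0 := by rintro rfl; simp at ha'; exact hz0 ha'.symm
      rw [← ha']
      exact rayleigh_const_smul ha0 ω _
    · rintro rfl
      exact ⟨w, w.2, hw0, rfl⟩
  have hwt : testFun ω w := hV w.2
  rw [hset, csSup_singleton, hwt.rayleigh_eq, le_div_iff₀ (hwt.integral_sq_pos hw0)]
  exact hc w hwt

theorem minMaxSet_two_nonempty (hω : IsOpen ω) {p q : ℝ × ℝ} (hp : p ∈ ω) (hq : q ∈ ω)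
    (hpq : p ≠ q) : (minMaxSet ω 2).Nonempty := by
  obtain ⟨f, hf, hfp⟩ := exists_testFun_eq_one (hω.sdiff (isClosed_singleton (x := q)))
    (⟨hp, hpq⟩ : p ∈ ω \ {q})
  obtain ⟨g, hg, hgq⟩ := exists_testFun_eq_one (hω.sdiff (isClosed_singleton (x := p)))
    (⟨hq, hpq.symm⟩ : q ∈ ω \ {p})
  have hfq : f q = 0 := hf.eq_zero (by simp)
  have hgp : g p = 0 := hg.eq_zero (by simp)
  have hli : LinearIndependent ℝ ![f, g] := by
    rw [LinearIndependent.pair_iff]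
    intro s t hst
    have h1 := congrFun hst p
    have h2 := congrFun hst q
    simp [hfp, hgp, hfq, hgq] at h1 h2
    exact ⟨h1, h2⟩
  refine ⟨_, Submodule.span ℝ (range ![f, g]), ?_, by simpa using finrank_span_eq_card hli, rfl⟩
  intro w hw
  simp only [Matrix.range_cons, Matrix.range_empty, union_empty, singleton_union] at hw
  obtain ⟨a, b, rfl⟩ := Submodule.mem_span_pair.1 hw
  exact ((hf.mono sdiff_subset).const_smul a).add ((hg.mono sdiff_subset).const_smul b)

theorem exists_ne_zero_of_finrank_two {E : Type*} [AddCommGroup E] [Module ℝ E]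
    (hE : Module.finrank ℝ E = 2) (L : E →ₗ[ℝ] ℝ) : ∃ x, x ≠ 0 ∧ L x = 0 := by
  have : FiniteDimensional ℝ E := Module.finite_of_finrank_pos (by omega)
  have h := L.ker_ne_bot_of_finrank_lt (by rw [hE, Module.finrank_self]; norm_num)
  obtain ⟨x, hx, hx0⟩ := Submodule.exists_mem_ne_zero_of_ne_bot h
  exact ⟨x, hx0, hx⟩

theorem gradSq_combination_le {v : ℝ × ℝ → ℝ} (hu : Differentiable ℝ u) (hv : Differentiable ℝ v)
    (a b : ℝ) (x : ℝ × ℝ) :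
    gradSq (a • u + b • v) x ≤ 2 * a ^ 2 * gradSq u x + 2 * b ^ 2 * gradSq v x := by
  have : fderiv ℝ (a • u + b • v) x = a • fderiv ℝ u x + b • fderiv ℝ v x := by
    rw [fderiv_add ((hu x).const_smul a) ((hv x).const_smul b), fderiv_const_smul_field,
      fderiv_const_smul_field]; rfl
  simp only [gradSq, this, add_apply, smul_apply,
    smul_eq_mul]
  nlinarith [sq_nonneg (a * fderiv ℝ u x (1, 0) - b * fderiv ℝ v x (1, 0)),
    sq_nonneg (a * fderiv ℝ u x (0, 1) - b * fderiv ℝ v x (0, 1))]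

/-- On a two-dimensional space of test functions the Rayleigh quotient is bounded. -/
theorem bddAbove_rayleigh {V : Submodule ℝ (ℝ × ℝ → ℝ)}
    (hV : (V : Set (ℝ × ℝ → ℝ)) ⊆ {u | testFun ω u}) (hdim : Module.finrank ℝ V = 2) :
    BddAbove {r | ∃ u ∈ V, u ≠ 0 ∧ r = rayleigh ω u} := by
  obtain ⟨⟨f, hfV⟩, hf0⟩ : ∃ f : V, f ≠ 0 := by
    have : Nontrivial V := Module.nontrivial_of_finrank_pos (R := ℝ) (by omega)
    exact exists_ne 0
  have hf : testFun ω f := hV hfV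
  have hprod : ∀ w ∈ V, Integrable fun x => f x * w x := fun w hw =>
    (hf.continuous.mul (hV hw).continuous).integrable_of_hasCompactSupport
      (hf.2.1.mul_right (f' := w))
  let L : V →ₗ[ℝ] ℝ :=
    { toFun := fun w => ∫ x, f x * w.1 x
      map_add' := fun w z => by
        rw [← integral_add (hprod _ w.2) (hprod _ z.2)]
        simp [mul_add]
      map_smul' := fun c w => by
        simp only [RingHom.id_apply, smul_eq_mul]
        rw [← integral_const_mul]
        congr 1; ext x
        simp; ring }
  obtain ⟨⟨g, hgV⟩, hg0, hL⟩ := exists_ne_zero_of_finrank_two hdim L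
  have hg : testFun ω g := hV hgV
  have horth : ∫ x, f x * g x = 0 := hL
  have hfpos := hf.integral_sq_pos (by simpa using hf0)
  have hgpos := hg.integral_sq_pos (by simpa using hg0)
  have hsq : ∀ a b : ℝ, ∫ x, (a • f + b • g) x ^ 2
      = a ^ 2 * (∫ x, f x ^ 2) + b ^ 2 * ∫ x, g x ^ 2 := by
    intro a b
    have : ∀ x, (a • f + b • g) x ^ 2
        = a ^ 2 * f x ^ 2 + b ^ 2 * g x ^ 2 + 2 * a * b * (f x * g x) := fun x => by
      simp only [Pi.add_apply, Pi.smul_apply, smul_eq_mul]; ring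
    simp_rw [this]
    rw [integral_add, integral_add, integral_const_mul, integral_const_mul, integral_const_mul,
      horth]
    · ring
    · exact hf.integrable_sq.const_mul _
    · exact hg.integrable_sq.const_mul _
    · exact (hf.integrable_sq.const_mul _).add (hg.integrable_sq.const_mul _)
    · exact (hprod g hgV).const_mul _
  have hli : LinearIndependent ℝ ![f, g] := by
    rw [LinearIndependent.pair_iff]
    intro a b hab
    have h := hsq a b
    rw [hab] at h
    simp only [Pi.zero_apply, ne_eq, OfNat.ofNat_ne_zero, not_false_eq_true, zero_pow,
      integral_zero] at h
    have ha : 0 ≤ a ^ 2 * ∫ x, f x ^ 2 := by positivity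
    have hb : 0 ≤ b ^ 2 * ∫ x, g x ^ 2 := by positivity
    constructor
    · have : a ^ 2 * ∫ x, f x ^ 2 = 0 := by linarith
      simpa [hfpos.ne'] using this
    · have : b ^ 2 * ∫ x, g x ^ 2 = 0 := by linarith
      simpa [hgpos.ne'] using this
  have hfin : FiniteDimensional ℝ V := Module.finite_of_finrank_pos (by omega)
  have hspan : Submodule.span ℝ (range ![f, g]) = V := by
    apply Submodule.eq_of_le_of_finrank_eq
    · rw [Submodule.span_le]
      rintro _ ⟨i, rfl⟩
      fin_cases i
      · exact hfV
      · exact hgV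
    · rw [hdim]
      simpa using finrank_span_eq_card hli
  set Cf := (∫ x, gradSq f x) / ∫ x, f x ^ 2 with hCf
  set Cg := (∫ x, gradSq g x) / ∫ x, g x ^ 2 with hCg
  have hCf0 : 0 ≤ Cf := div_nonneg (integral_nonneg (gradSq_nonneg f)) hfpos.le
  have hCg0 : 0 ≤ Cg := div_nonneg (integral_nonneg (gradSq_nonneg g)) hgpos.le
  refine ⟨2 * (Cf + Cg), ?_⟩
  rintro r ⟨w, hw, hw0, rfl⟩
  have hwt : testFun ω w := hV hw
  rw [hwt.rayleigh_eq, div_le_iff₀ (hwt.integral_sq_pos hw0)]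
  rw [← hspan] at hw
  simp only [Matrix.range_cons, Matrix.range_empty, union_empty, singleton_union] at hw
  obtain ⟨a, b, rfl⟩ := Submodule.mem_span_pair.1 hw
  calc ∫ x, gradSq (a • f + b • g) x
      ≤ ∫ x, (2 * a ^ 2 * gradSq f x + 2 * b ^ 2 * gradSq g x) :=
        integral_mono hwt.integrable_gradSq
          ((hf.integrable_gradSq.const_mul _).add (hg.integrable_gradSq.const_mul _))
          (gradSq_combination_le hf.differentiable hg.differentiable a b)
    _ = 2 * a ^ 2 * (Cf * ∫ x, f x ^ 2) + 2 * b ^ 2 * (Cg * ∫ x, g x ^ 2) := by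
        rw [integral_add (hf.integrable_gradSq.const_mul _) (hg.integrable_gradSq.const_mul _),
          integral_const_mul, integral_const_mul, hCf, hCg, div_mul_cancel₀ _ hfpos.ne',
          div_mul_cancel₀ _ hgpos.ne']
    _ ≤ 2 * (Cf + Cg) * ∫ x, (a • f + b • g) x ^ 2 := by
        rw [hsq]
        have h1 : 0 ≤ a ^ 2 * (Cg * ∫ x, f x ^ 2) := by positivity
        have h2 : 0 ≤ b ^ 2 * (Cf * ∫ x, g x ^ 2) := by positivity
        linarith

theorem le_dirichletEV_two (hω : IsOpen ω) {p q : ℝ × ℝ} (hp : p ∈ ω) (hq : q ∈ ω)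
    (hpq : p ≠ q) {c : ℝ} (L : (ℝ × ℝ → ℝ) → ℝ)
    (hadd : ∀ u v, testFun ω u → testFun ω v → L (u + v) = L u + L v)
    (hsmul : ∀ (a : ℝ) u, L (a • u) = a * L u)
    (hc : ∀ u, testFun ω u → L u = 0 → c * ∫ x, u x ^ 2 ≤ ∫ x, gradSq u x) :
    c ≤ dirichletEV ω 2 := by
  refine le_csInf (minMaxSet_two_nonempty hω hp hq hpq) ?_
  rintro l ⟨V, hV, hdim, rfl⟩
  let L' : V →ₗ[ℝ] ℝ :=
    { toFun := fun w => L w.1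
      map_add' := fun w z => hadd _ _ (hV w.2) (hV z.2)
      map_smul' := fun a w => hsmul a w.1 }
  obtain ⟨⟨w, hw⟩, hw0, hLw⟩ := exists_ne_zero_of_finrank_two hdim L'
  have hw0' : w ≠ 0 := by simpa using hw0
  have hwt : testFun ω w := hV hw
  refine le_trans ?_ (le_csSup (bddAbove_rayleigh hV hdim) ⟨w, hw, hw0', rfl⟩)
  rw [hwt.rayleigh_eq, le_div_iff₀ (hwt.integral_sq_pos hw0')]
  exact hc w hwt hLw

end Eigenvalues

section Polar

/-- The Euclidean distance to the origin. -/
def radius (x : ℝ × ℝ) : ℝ := √(x.1 ^ 2 + x.2 ^ 2)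

theorem radius_nonneg (x : ℝ × ℝ) : 0 ≤ radius x := Real.sqrt_nonneg _

theorem radius_sq (x : ℝ × ℝ) : radius x ^ 2 = x.1 ^ 2 + x.2 ^ 2 := Real.sq_sqrt (by positivity)

theorem continuous_radius : Continuous radius := by unfold radius; fun_prop

theorem sq_polar (r θ : ℝ) : (r * cos θ) ^ 2 + (r * sin θ) ^ 2 = r ^ 2 := by
  linear_combination r ^ 2 * Real.sin_sq_add_cos_sq θ

theorem radius_polar {r : ℝ} (hr : 0 ≤ r) (θ : ℝ) : radius (r * cos θ, r * sin θ) = r := by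
  simp only [radius, sq_polar]
  exact Real.sqrt_sq hr

theorem integral_polar (g : ℝ × ℝ → ℝ) :
    ∫ x, g x = ∫ p in Ioi (0 : ℝ) ×ˢ Ioo (-π) π, p.1 * g (p.1 * cos p.2, p.1 * sin p.2) :=
  (integral_comp_polarCoord_symm g).symm

theorem integral_radial (H : ℝ → ℝ) :
    ∫ x, H (radius x) = 2 * π * ∫ r in Ioi 0, r * H r := by
  rw [integral_polar]
  have h1 : ∫ p in Ioi (0 : ℝ) ×ˢ Ioo (-π) π, p.1 * H (radius (p.1 * cos p.2, p.1 * sin p.2))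
      = ∫ p in Ioi (0 : ℝ) ×ˢ Ioo (-π) π, (p.1 * H p.1) * (1 : ℝ) := by
    refine setIntegral_congr_fun (measurableSet_Ioi.prod measurableSet_Ioo) fun p hp => ?_
    simp only [radius_polar (le_of_lt hp.1), mul_one]
  rw [h1, Measure.volume_eq_prod, setIntegral_prod_mul (fun r => r * H r) (fun _ => (1 : ℝ))]
  simp only [integral_const, smul_eq_mul, mul_one, MeasurableSet.univ, measureReal_restrict_apply,
    univ_inter, Real.volume_real_Ioo_of_le (by linarith [Real.pi_pos] : -π ≤ π)]
  ring

theorem integrableOn_polar {g : ℝ × ℝ → ℝ} (hg : Continuous g) (hgc : HasCompactSupport g) :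
    IntegrableOn (fun p : ℝ × ℝ => p.1 * g (p.1 * cos p.2, p.1 * sin p.2))
      (Ioi (0 : ℝ) ×ˢ Ioo (-π) π) := by
  obtain ⟨M, hM⟩ := (hgc.isCompact.image continuous_radius).bddAbove
  have hc : Continuous fun p : ℝ × ℝ => p.1 * g (p.1 * cos p.2, p.1 * sin p.2) := by fun_prop
  have hK : IntegrableOn (fun p : ℝ × ℝ => p.1 * g (p.1 * cos p.2, p.1 * sin p.2))
      (Icc 0 M ×ˢ Icc (-π) π) :=
    hc.continuousOn.integrableOn_compact (isCompact_Icc.prod isCompact_Icc)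
  refine hK.of_forall_sdiff_eq_zero (measurableSet_Ioi.prod measurableSet_Ioo) ?_
  rintro ⟨r, θ⟩ ⟨⟨hr, hθ⟩, hnot⟩
  have hr0 : 0 < r := hr
  have hrM : M < r := by
    by_contra h
    exact hnot ⟨⟨hr0.le, not_lt.1 h⟩, hθ.1.le, hθ.2.le⟩
  have : (r * cos θ, r * sin θ) ∉ tsupport g := fun h => by
    have := hM (mem_image_of_mem radius h)
    rw [radius_polar hr0.le] at this
    linarith
  simp [image_eq_zero_of_notMem_tsupport this]

/-- An inequality between weighted integrals along all rays integrates to the plane. -/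
theorem integral_le_of_forall_ray {g h : ℝ × ℝ → ℝ} (hg : Continuous g)
    (hgc : HasCompactSupport g) (hh : Continuous h) (hhc : HasCompactSupport h)
    (hle : ∀ θ : ℝ, ∫ r in Ioi 0, r * g (r * cos θ, r * sin θ)
      ≤ ∫ r in Ioi 0, r * h (r * cos θ, r * sin θ)) :
    ∫ x, g x ≤ ∫ x, h x := by
  have hgi := integrableOn_polar hg hgc
  have hhi := integrableOn_polar hh hhc
  rw [integral_polar g, integral_polar h]
  unfold IntegrableOn at hgi hhi
  rw [Measure.volume_eq_prod, ← Measure.prod_restrict] at *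
  rw [integral_prod_symm _ hgi, integral_prod_symm _ hhi]
  exact integral_mono hgi.integral_prod_right hhi.integral_prod_right hle

theorem gradSq_comp_radius {H : ℝ → ℝ} {H' : ℝ} {x : ℝ × ℝ} (hx : 0 < radius x)
    (hH : HasDerivAt H H' (radius x)) : gradSq (fun y => H (radius y)) x = H' ^ 2 := by
  have hpos : 0 < x.1 ^ 2 + x.2 ^ 2 := by rw [← radius_sq]; positivity
  have h1 : HasFDerivAt (fun y : ℝ × ℝ => y.1 ^ 2 + y.2 ^ 2)
      ((2 * x.1) • ContinuousLinearMap.fst ℝ ℝ ℝ + (2 * x.2) • ContinuousLinearMap.snd ℝ ℝ ℝ)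
      x := by
    have ha := (hasFDerivAt_fst (𝕜 := ℝ) (p := x)).pow 2
    have hb := (hasFDerivAt_snd (𝕜 := ℝ) (p := x)).pow 2
    refine (ha.add hb).congr_fderiv ?_
    ext <;> simp
  have h2 := hH.comp_hasFDerivAt x (h1.sqrt hpos.ne')
  have h3 : fderiv ℝ (fun y => H (radius y)) x = _ := h2.fderiv
  have hr : √(x.1 ^ 2 + x.2 ^ 2) = radius x := rfl
  simp only [gradSq, h3, hr, smul_apply, add_apply, ContinuousLinearMap.coe_fst',
    ContinuousLinearMap.coe_snd', smul_eq_mul]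
  field_simp
  linear_combination (-H' ^ 2) * radius_sq x

theorem integral_gradSq_radial {H H' : ℝ → ℝ} (hH : ∀ r, 0 < r → HasDerivAt H (H' r) r) :
    ∫ x, gradSq (fun y => H (radius y)) x = 2 * π * ∫ r in Ioi 0, r * H' r ^ 2 := by
  rw [← integral_radial fun r => H' r ^ 2, integral_polar, integral_polar]
  refine setIntegral_congr_fun (measurableSet_Ioi.prod measurableSet_Ioo) fun p hp => ?_
  have h0 : 0 < radius (p.1 * cos p.2, p.1 * sin p.2) := by
    rw [radius_polar (le_of_lt hp.1)]; exact hp.1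
  simp only [gradSq_comp_radius h0 (hH _ h0)]

/-- The radial derivative of `u` along the ray of angle `θ`. -/
def rayDeriv (u : ℝ × ℝ → ℝ) (θ r : ℝ) : ℝ :=
  fderiv ℝ u (r * cos θ, r * sin θ) (cos θ, sin θ)

theorem hasDerivAt_ray {u : ℝ × ℝ → ℝ} (hu : Differentiable ℝ u) (θ r : ℝ) :
    HasDerivAt (fun r => u (r * cos θ, r * sin θ)) (rayDeriv u θ r) r := by
  have h : HasDerivAt (fun r : ℝ => (r * cos θ, r * sin θ)) (cos θ, sin θ) r := by
    simpa using ((hasDerivAt_id r).mul_const (cos θ)).prodMk ((hasDerivAt_id r).mul_const (sin θ))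
  exact (hu _).hasFDerivAt.comp_hasDerivAt r h

theorem rayDeriv_sq_le (u : ℝ × ℝ → ℝ) (θ r : ℝ) :
    rayDeriv u θ r ^ 2 ≤ gradSq u (r * cos θ, r * sin θ) := by
  unfold rayDeriv gradSq
  set L := fderiv ℝ u (r * cos θ, r * sin θ)
  have : (cos θ, sin θ) = cos θ • ((1 : ℝ), (0 : ℝ)) + sin θ • ((0 : ℝ), (1 : ℝ)) := by simp
  rw [this, map_add, map_smul, map_smul]
  simp only [smul_eq_mul]
  have h := Real.sin_sq_add_cos_sq θ
  have h2 : L (1, 0) ^ 2 + L (0, 1) ^ 2 - (cos θ * L (1, 0) + sin θ * L (0, 1)) ^ 2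
      = (sin θ * L (1, 0) - cos θ * L (0, 1)) ^ 2 := by
    linear_combination (-(L (1, 0) ^ 2 + L (0, 1) ^ 2)) * h
  nlinarith [sq_nonneg (sin θ * L (1, 0) - cos θ * L (0, 1))]

theorem continuous_rayDeriv {ω : Set (ℝ × ℝ)} {u : ℝ × ℝ → ℝ} (hu : testFun ω u) (θ : ℝ) :
    Continuous (rayDeriv u θ) :=
  (hu.continuous_fderiv.comp (by fun_prop)).clm_apply continuous_const

end Polar

section Annuli

theorem isOpen_disk (R : ℝ) : IsOpen (disk R) :=
  isOpen_lt (by fun_prop) continuous_const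

theorem closure_disk {R : ℝ} (hR : 0 < R) : closure (disk R) = {x | x.1 ^ 2 + x.2 ^ 2 ≤ R ^ 2} := by
  apply Subset.antisymm
  · refine closure_minimal (fun x hx => ?_) (isClosed_le (by fun_prop) continuous_const)
    have hx' : x.1 ^ 2 + x.2 ^ 2 < R ^ 2 := hx
    exact hx'.le
  · intro x hx
    have hx' : x.1 ^ 2 + x.2 ^ 2 ≤ R ^ 2 := hx
    have hmaps : MapsTo (fun t : ℝ => t • x) (Ioo 0 1) (disk R) := by
      intro t ht
      change (t * x.1) ^ 2 + (t * x.2) ^ 2 < R ^ 2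
      have h1 : t ^ 2 < 1 := by nlinarith [ht.1, ht.2]
      nlinarith [sq_nonneg t, sq_nonneg x.1, sq_nonneg x.2, sq_pos_of_pos hR]
    have h1 : (1 : ℝ) ∈ closure (Ioo (0 : ℝ) 1) := by
      rw [closure_Ioo zero_ne_one]; simp
    simpa using map_mem_closure (f := fun t : ℝ => t • x) (by fun_prop) h1 hmaps

theorem mem_annulus_iff {R₁ R₂ : ℝ} (h₁ : 0 < R₁) {x : ℝ × ℝ} :
    x ∈ annulus R₁ R₂ ↔ R₁ ^ 2 < x.1 ^ 2 + x.2 ^ 2 ∧ x.1 ^ 2 + x.2 ^ 2 < R₂ ^ 2 := by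
  rw [annulus, closure_disk h₁, mem_sdiff, and_comm]
  simp [disk]

theorem isOpen_annulus (R₁ R₂ : ℝ) : IsOpen (annulus R₁ R₂) :=
  (isOpen_disk R₂).sdiff isClosed_closure

theorem annulus_nonempty {R₁ R₂ : ℝ} (h₁ : 0 < R₁) (h : R₁ < R₂) : (annulus R₁ R₂).Nonempty := by
  refine ⟨((R₁ + R₂) / 2, 0), (mem_annulus_iff h₁).2 ⟨?_, ?_⟩⟩ <;> simp only <;> nlinarith

theorem dirichletEV_annulus_anti {R₁ R₂ R₃ : ℝ} (h₁ : 0 < R₁) (h : R₁ < R₂) (h' : R₂ ≤ R₃) :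
    dirichletEV (annulus R₁ R₃) 1 ≤ dirichletEV (annulus R₁ R₂) 1 := by
  refine le_dirichletEV_one (isOpen_annulus _ _) (annulus_nonempty h₁ h) fun u hu => ?_
  refine dirichletEV_one_mul_le (hu.mono fun x hx => ?_)
  rw [mem_annulus_iff h₁] at hx ⊢
  exact ⟨hx.1, hx.2.trans_le (by nlinarith)⟩

theorem dirichletEV_annulus_le_disk {R₁ R₂ : ℝ} (h₁ : 0 < R₁) (h : 3 * R₁ ≤ R₂) :
    dirichletEV (annulus R₁ R₂) 1 ≤ dirichletEV (disk R₁) 1 := by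
  refine le_dirichletEV_one (isOpen_disk _) ⟨0, by simp [disk, sq_pos_of_pos h₁]⟩
    fun u hu => ?_
  set c : ℝ × ℝ := (2 * R₁, 0) with hc
  have hv : testFun (annulus R₁ R₂) fun x => u (x - c) := by
    refine ⟨hu.1.comp (contDiff_id.sub contDiff_const), ?_, ?_⟩
    · exact hu.2.1.comp_homeomorph (Homeomorph.subRight c)
    · have hsub : tsupport (fun x => u (x - c)) ⊆ (fun x => x - c) ⁻¹' tsupport u :=
        closure_minimal (fun x hx => subset_tsupport u hx)
          ((isClosed_tsupport u).preimage (by fun_prop))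
      intro x hx
      have hx' : (x.1 - 2 * R₁) ^ 2 + (x.2 - 0) ^ 2 < R₁ ^ 2 := hu.2.2 (hsub hx)
      have hlo : R₁ < x.1 := by nlinarith [sq_nonneg x.2]
      have hhi : x.1 < 3 * R₁ := by nlinarith [sq_nonneg x.2]
      have h9 : (3 * R₁) ^ 2 ≤ R₂ ^ 2 := by nlinarith
      rw [mem_annulus_iff h₁]
      constructor <;> nlinarith [sq_nonneg x.2]
  have hgrad : ∀ x, gradSq (fun x => u (x - c)) x = gradSq u (x - c) := fun x => by
    simp only [gradSq, fderiv_comp_sub]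
  have h := dirichletEV_one_mul_le hv
  simp_rw [hgrad] at h
  rwa [integral_sub_right_eq_self (gradSq u), integral_sub_right_eq_self fun x => u x ^ 2] at h

end Annuli

section Comparison

theorem abs_fst_le_radius (x : ℝ × ℝ) : |x.1| ≤ radius x :=
  Real.abs_le_sqrt (by linarith [sq_nonneg x.2])

theorem abs_snd_le_radius (x : ℝ × ℝ) : |x.2| ≤ radius x :=
  Real.abs_le_sqrt (by linarith [sq_nonneg x.1])

theorem isCompact_radius_preimage {K : Set ℝ} (hK : IsCompact K) : IsCompact (radius ⁻¹' K) := by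
  obtain ⟨M, hM⟩ := hK.bddAbove
  refine (isCompact_closedBall (0 : ℝ × ℝ) M).of_isClosed_subset
    (hK.isClosed.preimage continuous_radius) fun x hx => ?_
  have hr : radius x ≤ M := hM hx
  rw [mem_closedBall_zero_iff, Prod.norm_def]
  exact max_le ((abs_fst_le_radius x).trans hr) ((abs_snd_le_radius x).trans hr)

theorem testFun_comp_radius {ω : Set (ℝ × ℝ)} {H : ℝ → ℝ} (hH : ContDiff ℝ (⊤ : ℕ∞) H) {K : Set ℝ}
    (hK : IsCompact K) (hK0 : ∀ r ∈ K, 0 < r) (hHK : ∀ r, 0 ≤ r → r ∉ K → H r = 0)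
    (hω : ∀ x, radius x ∈ K → x ∈ ω) : testFun ω fun x => H (radius x) := by
  have hzero : ∀ x, x ∉ radius ⁻¹' K → H (radius x) = 0 := fun x hx =>
    hHK _ (radius_nonneg x) hx
  have hclosed : IsClosed (radius ⁻¹' K) := hK.isClosed.preimage continuous_radius
  refine ⟨contDiff_iff_contDiffAt.2 fun x => ?_,
    HasCompactSupport.intro (isCompact_radius_preimage hK) hzero, fun x hx => hω x ?_⟩
  · by_cases hx : x ∈ radius ⁻¹' K
    · have hpos : 0 < x.1 ^ 2 + x.2 ^ 2 := by
        rw [← radius_sq]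
        have := hK0 _ hx
        positivity
      have h1 : ContDiffAt ℝ (⊤ : ℕ∞) radius x :=
        ContDiffAt.sqrt (by fun_prop) hpos.ne'
      exact hH.contDiffAt.comp x h1
    · refine (contDiffAt_const (c := (0 : ℝ))).congr_of_eventuallyEq ?_
      filter_upwards [hclosed.isOpen_compl.mem_nhds hx] with y hy using hzero y hy
  · refine closure_minimal (fun y hy => ?_) hclosed hx
    by_contra h
    exact hy (hzero y h)

theorem setIntegral_Ioi_eq_intervalIntegral {h : ℝ → ℝ} {a b : ℝ} (ha : 0 ≤ a) (hab : a ≤ b)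
    (h0 : ∀ r, 0 < r → r ∉ Ioo a b → h r = 0) :
    ∫ r in Ioi 0, r * h r = ∫ r in a..b, r * h r := by
  rw [intervalIntegral.integral_of_le hab]
  refine setIntegral_eq_of_subset_of_forall_sdiff_eq_zero measurableSet_Ioi
    (fun r hr => lt_of_le_of_lt ha hr.1) fun r hr => ?_
  rw [h0 r hr.1 fun hr' => hr.2 ⟨hr'.1, hr'.2.le⟩, mul_zero]

theorem mem_Ioo_of_ray_mem_annulus {R₁ R₂ θ r : ℝ} (h₁ : 0 < R₁) (h₂ : R₁ < R₂) (hr : -R₁ < r)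
    (h : (r * cos θ, r * sin θ) ∈ annulus R₁ R₂) : r ∈ Ioo R₁ R₂ := by
  rw [mem_annulus_iff h₁] at h
  simp only [sq_polar] at h
  have h₃ : R₁ < r := by
    rcases (sq_lt_sq.1 h.1) with h'
    rw [abs_of_pos h₁, lt_abs] at h'
    rcases h' with h' | h'
    · exact h'
    · linarith
  exact ⟨h₃, lt_of_pow_lt_pow_left₀ 2 (by linarith) h.2⟩

/-- Stretching rays: the comparison of weighted one-dimensional energies. -/
theorem dirichletEV_annulus_mul_ray_le {R₁ R R' : ℝ} (h₁ : 0 < R₁) (hR : R₁ < R) (hR' : R ≤ R')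
    (hlt : R' - R₁ < 2 * (R - R₁)) {u : ℝ × ℝ → ℝ} (hu : testFun (annulus R₁ R') u) (θ : ℝ) :
    dirichletEV (annulus R₁ R) 1 * ∫ r in R₁..R', r * u (r * cos θ, r * sin θ) ^ 2
      ≤ ((R' - R₁) / (R - R₁)) ^ 3 * ∫ r in R₁..R', r * rayDeriv u θ r ^ 2 := by
  set κ := (R' - R₁) / (R - R₁) with hκ
  have hd : 0 < R - R₁ := sub_pos.2 hR
  have hκR : κ * (R - R₁) = R' - R₁ := by rw [hκ]; field_simp
  have hκ1 : 1 ≤ κ := by rw [hκ, one_le_div hd]; linarith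
  have hκ2 : κ < 2 := by rw [hκ, div_lt_iff₀ hd]; linarith
  have hκ0 : 0 < κ := by linarith
  set f : ℝ → ℝ := fun r => u (r * cos θ, r * sin θ) with hf
  set f' : ℝ → ℝ := rayDeriv u θ with hf'
  have hfd : ∀ r, HasDerivAt f (f' r) r := hasDerivAt_ray hu.differentiable θ
  have hfc : Continuous f := hu.continuous.comp (by fun_prop)
  have hf'c : Continuous f' := continuous_rayDeriv hu θ
  set τ : ℝ → ℝ := fun r => κ * r + (R₁ - κ * R₁) with hτ
  have hτc : Continuous τ := by fun_prop
  have hmem : ∀ r, 0 ≤ r → (τ r * cos θ, τ r * sin θ) ∈ annulus R₁ R' → r ∈ Ioo R₁ R := by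
    intro r hr h
    have hb : -R₁ < τ r := by simp only [hτ]; nlinarith
    obtain ⟨ha, hb⟩ := mem_Ioo_of_ray_mem_annulus h₁ (hR.trans_le hR') hb h
    simp only [hτ] at ha hb
    constructor
    · have : 0 < κ * (r - R₁) := by linarith
      have := pos_of_mul_pos_right this hκ0.le
      linarith
    · have : 0 < κ * (R - r) := by linarith
      have := pos_of_mul_pos_right this hκ0.le
      linarith
  set K : Set ℝ := Icc R₁ R ∩ (fun r => (τ r * cos θ, τ r * sin θ)) ⁻¹' tsupport u with hK
  have hKc : IsCompact K :=
    isCompact_Icc.inter_right ((isClosed_tsupport u).preimage (by fun_prop))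
  have hv : testFun (annulus R₁ R) fun x => f (τ (radius x)) := by
    refine testFun_comp_radius (H := fun r => f (τ r)) ?_ hKc (fun r hr => h₁.trans_le hr.1.1)
      (fun r hr hrK => ?_) (fun x hx => ?_)
    · exact hu.1.comp (by fun_prop)
    · by_contra hne
      have hs : (τ r * cos θ, τ r * sin θ) ∈ tsupport u := subset_tsupport u hne
      have := hmem r hr (hu.2.2 hs)
      exact hrK ⟨⟨this.1.le, this.2.le⟩, hs⟩
    · have h := hmem _ (radius_nonneg x) (hu.2.2 hx.2)
      rw [mem_annulus_iff h₁, ← radius_sq]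
      exact ⟨pow_lt_pow_left₀ h.1 h₁.le two_ne_zero,
        pow_lt_pow_left₀ h.2 (radius_nonneg x) two_ne_zero⟩
  have hlam := dirichletEV_one_mul_le hv
  have hderiv : ∀ r, HasDerivAt (fun r => f (τ r)) (κ * f' (τ r)) r := by
    intro r
    have hτd : HasDerivAt τ κ r :=
      (((hasDerivAt_id r).const_mul κ).add_const (R₁ - κ * R₁)).congr_deriv (mul_one κ)
    rw [mul_comm]
    exact (hfd (τ r)).comp r hτd
  rw [integral_radial fun r => f (τ r) ^ 2,
    integral_gradSq_radial (H := fun r => f (τ r)) fun r _ => hderiv r,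
    setIntegral_Ioi_eq_intervalIntegral (h := fun r => f (τ r) ^ 2) h₁.le hR.le,
    setIntegral_Ioi_eq_intervalIntegral (h := fun r => (κ * f' (τ r)) ^ 2) h₁.le hR.le] at hlam
  rotate_left
  · intro r hr hnot
    have : f' (τ r) = 0 := by
      simp only [hf', rayDeriv]
      rw [hu.fderiv_eq_zero fun h => hnot (hmem r hr.le h)]
      simp
    simp [this]
  · intro r hr hnot
    have : f (τ r) = 0 := hu.eq_zero fun h => hnot (hmem r hr.le h)
    simp [this]
  have hsubst : ∀ ψ : ℝ → ℝ, ∫ r in R₁..R, ψ (τ r) = κ⁻¹ * ∫ t in R₁..R', ψ t := by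
    intro ψ
    have := intervalIntegral.integral_comp_mul_add (a := R₁) (b := R) ψ hκ0.ne' (R₁ - κ * R₁)
    rw [this, smul_eq_mul]
    congr 2
    · ring
    · linarith
  have hA : κ⁻¹ * (κ⁻¹ * ∫ t in R₁..R', t * f t ^ 2) ≤ ∫ r in R₁..R, r * f (τ r) ^ 2 := by
    rw [← hsubst fun t => t * f t ^ 2, ← intervalIntegral.integral_const_mul]
    refine intervalIntegral.integral_mono_on hR.le
      (Continuous.intervalIntegrable (by fun_prop) _ _)
      (Continuous.intervalIntegrable (by fun_prop) _ _) fun r hr => ?_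
    rw [← mul_assoc]
    refine mul_le_mul_of_nonneg_right ?_ (sq_nonneg _)
    rw [inv_mul_le_iff₀ hκ0]
    simp only [hτ]
    nlinarith
  have hB : ∫ r in R₁..R, r * (κ * f' (τ r)) ^ 2 ≤ κ ^ 2 * (κ⁻¹ * ∫ t in R₁..R', t * f' t ^ 2) := by
    rw [← hsubst fun t => t * f' t ^ 2, ← intervalIntegral.integral_const_mul]
    refine intervalIntegral.integral_mono_on hR.le
      (Continuous.intervalIntegrable (by fun_prop) _ _)
      (Continuous.intervalIntegrable (by fun_prop) _ _) fun r hr => ?_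
    have h : r ≤ τ r := by
      simp only [hτ]
      nlinarith [hr.1, hr.2]
    have : 0 ≤ (κ * f' (τ r)) ^ 2 := sq_nonneg _
    calc r * (κ * f' (τ r)) ^ 2 ≤ τ r * (κ * f' (τ r)) ^ 2 := mul_le_mul_of_nonneg_right h this
      _ = κ ^ 2 * (τ r * f' (τ r) ^ 2) := by ring
  set Λ := dirichletEV (annulus R₁ R) 1 with hΛ
  have hΛ0 : 0 ≤ Λ := dirichletEV_nonneg _ _
  set A := ∫ t in R₁..R', t * f t ^ 2
  set B := ∫ t in R₁..R', t * f' t ^ 2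
  have hlam' : Λ * ∫ r in R₁..R, r * f (τ r) ^ 2 ≤ ∫ r in R₁..R, r * (κ * f' (τ r)) ^ 2 := by
    have h2π : 0 < 2 * π := by positivity
    refine le_of_mul_le_mul_left ?_ h2π
    calc _ = Λ * (2 * π * ∫ r in R₁..R, r * f (τ r) ^ 2) := by ring
      _ ≤ _ := hlam
  have h := (mul_le_mul_of_nonneg_left hA hΛ0).trans (hlam'.trans hB)
  calc Λ * A = κ ^ 2 * (Λ * (κ⁻¹ * (κ⁻¹ * A))) := by field_simp
    _ ≤ κ ^ 2 * (κ ^ 2 * (κ⁻¹ * B)) := mul_le_mul_of_nonneg_left h (sq_nonneg _)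
    _ = κ ^ 3 * B := by field_simp

/-- A ray-wise Poincaré inequality on an annulus bounds its first eigenvalue from below. -/
theorem le_dirichletEV_annulus_of_ray {R₁ R₂ c : ℝ} (h₁ : 0 < R₁) (h₂ : R₁ < R₂)
    (hc : ∀ u, testFun (annulus R₁ R₂) u → ∀ θ : ℝ,
      c * ∫ r in R₁..R₂, r * u (r * cos θ, r * sin θ) ^ 2
        ≤ ∫ r in R₁..R₂, r * rayDeriv u θ r ^ 2) :
    c ≤ dirichletEV (annulus R₁ R₂) 1 := by
  refine le_dirichletEV_one (isOpen_annulus _ _) (annulus_nonempty h₁ h₂) fun u hu => ?_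
  rw [← integral_const_mul]
  refine integral_le_of_forall_ray (hu.continuous.pow 2 |>.const_mul c)
    (hu.hasCompactSupport_sq.mul_left (f := fun _ => c)) hu.continuous_gradSq
    hu.hasCompactSupport_gradSq fun θ => ?_
  have hmem : ∀ r, 0 < r → r ∉ Ioo R₁ R₂ → (r * cos θ, r * sin θ) ∉ annulus R₁ R₂ :=
    fun r hr hnot h => hnot (mem_Ioo_of_ray_mem_annulus h₁ h₂ (by linarith) h)
  rw [setIntegral_Ioi_eq_intervalIntegral (h := fun r => c * u (r * cos θ, r * sin θ) ^ 2)
      h₁.le h₂.le fun r hr hnot => by simp [hu.eq_zero (hmem r hr hnot)],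
    setIntegral_Ioi_eq_intervalIntegral (h := fun r => gradSq u (r * cos θ, r * sin θ))
      h₁.le h₂.le fun r hr hnot => hu.gradSq_eq_zero (hmem r hr hnot)]
  have hc1 : Continuous fun r : ℝ => gradSq u (r * cos θ, r * sin θ) :=
    hu.continuous_gradSq.comp (by fun_prop)
  have hc2 : Continuous (rayDeriv u θ) := continuous_rayDeriv hu θ
  calc ∫ r in R₁..R₂, r * (c * u (r * cos θ, r * sin θ) ^ 2)
      = c * ∫ r in R₁..R₂, r * u (r * cos θ, r * sin θ) ^ 2 := by
        rw [← intervalIntegral.integral_const_mul]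
        congr 1; ext r; ring
    _ ≤ ∫ r in R₁..R₂, r * rayDeriv u θ r ^ 2 := hc u hu θ
    _ ≤ ∫ r in R₁..R₂, r * gradSq u (r * cos θ, r * sin θ) :=
        intervalIntegral.integral_mono_on h₂.le (Continuous.intervalIntegrable (by fun_prop) _ _)
          (Continuous.intervalIntegrable (by fun_prop) _ _) fun r hr =>
          mul_le_mul_of_nonneg_left (rayDeriv_sq_le u θ r) (h₁.le.trans hr.1)

theorem dirichletEV_annulus_le_mul {R₁ R R' : ℝ} (h₁ : 0 < R₁) (hR : R₁ < R) (hR' : R ≤ R')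
    (hlt : R' - R₁ < 2 * (R - R₁)) :
    dirichletEV (annulus R₁ R) 1
      ≤ ((R' - R₁) / (R - R₁)) ^ 3 * dirichletEV (annulus R₁ R') 1 := by
  have hκ : 0 < ((R' - R₁) / (R - R₁)) ^ 3 :=
    pow_pos (div_pos (by linarith) (by linarith)) 3
  rw [← div_le_iff₀' hκ]
  refine le_dirichletEV_annulus_of_ray h₁ (hR.trans_le hR') fun u hu θ => ?_
  rw [div_mul_eq_mul_div, div_le_iff₀' hκ]
  exact dirichletEV_annulus_mul_ray_le h₁ hR hR' hlt hu θ

theorem inv_sq_le_dirichletEV_annulus {R₁ R₂ : ℝ} (h₁ : 0 < R₁) (h₂ : R₁ < R₂)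
    (h₃ : R₂ ≤ 2 * R₁) : ((R₂ - R₁) ^ 2)⁻¹ ≤ dirichletEV (annulus R₁ R₂) 1 := by
  refine le_dirichletEV_annulus_of_ray h₁ h₂ fun u hu θ => ?_
  have hd : 0 < (R₂ - R₁) ^ 2 := pow_pos (sub_pos.2 h₂) 2
  rw [inv_mul_le_iff₀ hd]
  have hfc : Continuous fun r : ℝ => u (r * cos θ, r * sin θ) := hu.continuous.comp (by fun_prop)
  have hf'c : Continuous (rayDeriv u θ) := continuous_rayDeriv hu θ
  have hzero : u (R₁ * cos θ, R₁ * sin θ) = 0 := hu.eq_zero fun h =>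
    lt_irrefl _ (mem_Ioo_of_ray_mem_annulus h₁ h₂ (by linarith) h).1
  have hp := poincare_left (hasDerivAt_ray hu.differentiable θ) hf'c h₂.le hzero
  have hA : ∫ r in R₁..R₂, r * u (r * cos θ, r * sin θ) ^ 2
      ≤ R₂ * ∫ r in R₁..R₂, u (r * cos θ, r * sin θ) ^ 2 := by
    rw [← intervalIntegral.integral_const_mul]
    exact intervalIntegral.integral_mono_on h₂.le
      ((continuous_id.mul (hfc.pow 2)).intervalIntegrable _ _)
      ((continuous_const.mul (hfc.pow 2)).intervalIntegrable _ _) fun r hr =>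
      mul_le_mul_of_nonneg_right hr.2 (sq_nonneg _)
  have hB : R₁ * ∫ r in R₁..R₂, rayDeriv u θ r ^ 2 ≤ ∫ r in R₁..R₂, r * rayDeriv u θ r ^ 2 := by
    rw [← intervalIntegral.integral_const_mul]
    exact intervalIntegral.integral_mono_on h₂.le (Continuous.intervalIntegrable (by fun_prop) _ _)
      (Continuous.intervalIntegrable (by fun_prop) _ _) fun r hr =>
      mul_le_mul_of_nonneg_right hr.1 (sq_nonneg _)
  have hB0 : 0 ≤ ∫ r in R₁..R₂, rayDeriv u θ r ^ 2 :=
    intervalIntegral.integral_nonneg h₂.le fun r _ => sq_nonneg _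
  set I := ∫ r in R₁..R₂, rayDeriv u θ r ^ 2
  calc _ ≤ R₂ * ((R₂ - R₁) ^ 2 / 2 * I) :=
        hA.trans (mul_le_mul_of_nonneg_left hp (by linarith))
    _ = R₂ * ((R₂ - R₁) ^ 2 / 2 * I) := rfl
    _ ≤ 2 * R₁ * ((R₂ - R₁) ^ 2 / 2 * I) := mul_le_mul_of_nonneg_right h₃ (by positivity)
    _ = (R₂ - R₁) ^ 2 * (R₁ * I) := by ring
    _ ≤ _ := mul_le_mul_of_nonneg_left hB hd.le

end Comparison

section FirstEigenvalueDisk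

/-- A smooth ramp vanishing on `(-∞, 1/32]`, of slope at most one, and of slope one on
`[1/16, ∞)`. -/
def ramp (s : ℝ) : ℝ := ∫ t in 0..s, Real.smoothTransition (32 * t - 1)

theorem continuous_ramp_slope : Continuous fun t : ℝ => Real.smoothTransition (32 * t - 1) :=
  Real.smoothTransition.continuous.comp (by fun_prop)

theorem hasDerivAt_ramp (s : ℝ) : HasDerivAt ramp (Real.smoothTransition (32 * s - 1)) s :=
  intervalIntegral.integral_hasDerivAt_right (continuous_ramp_slope.intervalIntegrable _ _)
    (continuous_ramp_slope.stronglyMeasurableAtFilter _ _) continuous_ramp_slope.continuousAt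

theorem contDiff_ramp : ContDiff ℝ (⊤ : ℕ∞) ramp := by
  rw [contDiff_infty_iff_deriv]
  refine ⟨fun s => (hasDerivAt_ramp s).differentiableAt, ?_⟩
  have : deriv ramp = fun s => Real.smoothTransition (32 * s - 1) :=
    funext fun s => (hasDerivAt_ramp s).deriv
  rw [this]
  exact Real.smoothTransition.contDiff.comp (by fun_prop)

theorem ramp_eq_zero {s : ℝ} (hs : s ≤ 1 / 32) : ramp s = 0 := by
  refine intervalIntegral.integral_zero_ae (Filter.Eventually.of_forall fun t ht => ?_)
  refine Real.smoothTransition.zero_of_nonpos ?_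
  rcases mem_uIoc.1 ht with h | h <;> linarith [h.1, h.2]

theorem sub_le_ramp {s : ℝ} (hs : 1 / 16 ≤ s) : s - 1 / 16 ≤ ramp s := by
  have hmono : ∫ t in (1 / 16)..s, Real.smoothTransition (32 * t - 1) ≤ ramp s :=
    intervalIntegral.integral_mono_interval (by norm_num) hs le_rfl
      (Filter.Eventually.of_forall fun t => Real.smoothTransition.nonneg _)
      (continuous_ramp_slope.intervalIntegrable _ _)
  refine le_trans (le_of_eq ?_) hmono
  have : ∫ t in (1 / 16)..s, Real.smoothTransition (32 * t - 1) = ∫ t in (1 / 16)..s, (1 : ℝ) := by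
    refine intervalIntegral.integral_congr fun t ht => ?_
    rw [uIcc_of_le hs] at ht
    exact Real.smoothTransition.one_of_one_le (by linarith [ht.1])
  rw [this]
  simp

theorem dirichletEV_disk_one_lt {R : ℝ} (hR : 0 < R) : dirichletEV (disk R) 1 < 8 / R ^ 2 := by
  have hR2 : 0 < R ^ 2 := by positivity
  set H : ℝ → ℝ := fun r => ramp (1 - r ^ 2 / R ^ 2) with hH
  set H' : ℝ → ℝ := fun r =>
    Real.smoothTransition (32 * (1 - r ^ 2 / R ^ 2) - 1) * (-(2 * r / R ^ 2)) with hH'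
  have hder : ∀ r, HasDerivAt H (H' r) r := fun r => by
    have h1 : HasDerivAt (fun r : ℝ => 1 - r ^ 2 / R ^ 2) (-(2 * r / R ^ 2)) r := by
      simpa using ((hasDerivAt_pow 2 r).div_const (R ^ 2)).const_sub 1
    exact (hasDerivAt_ramp _).comp r h1
  have hHc : Continuous H := continuous_iff_continuousAt.2 fun x => (hder x).continuousAt
  have hH'c : Continuous H' :=
    (continuous_ramp_slope.comp (by fun_prop : Continuous fun r : ℝ => 1 - r ^ 2 / R ^ 2)).mul
      (by fun_prop)
  have hsmall : ∀ r, 0 < r → r ∉ Ioo 0 R → 1 - r ^ 2 / R ^ 2 ≤ 0 := by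
    intro r hr hnot
    have hrR : R ≤ r := by
      by_contra h
      exact hnot ⟨hr, not_le.1 h⟩
    rw [sub_nonpos, one_le_div hR2]
    exact pow_le_pow_left₀ hR.le hrR 2
  have hu : testFun (disk R) fun x => H (radius x) := by
    have hclosed : IsClosed {x : ℝ × ℝ | 1 / 32 ≤ 1 - radius x ^ 2 / R ^ 2} :=
      isClosed_le continuous_const
        (continuous_const.sub ((continuous_radius.pow 2).div_const _))
    have hsub : tsupport (fun x => H (radius x)) ⊆ {x | 1 / 32 ≤ 1 - radius x ^ 2 / R ^ 2} := by
      refine closure_minimal (fun x hx => ?_) hclosed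
      by_contra h
      have h' : ¬ (1 / 32 ≤ 1 - radius x ^ 2 / R ^ 2) := h
      exact hx (ramp_eq_zero (not_le.1 h').le)
    have hdisk : tsupport (fun x => H (radius x)) ⊆ disk R := by
      intro x hx
      have h : 1 / 32 ≤ 1 - radius x ^ 2 / R ^ 2 := hsub hx
      have h2 : radius x ^ 2 / R ^ 2 < 1 := by linarith
      rw [div_lt_one hR2, radius_sq] at h2
      exact h2
    refine ⟨?_, ?_, hdisk⟩
    · have : (fun x => H (radius x)) = fun x : ℝ × ℝ => ramp (1 - (x.1 ^ 2 + x.2 ^ 2) / R ^ 2) := by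
        ext x
        simp only [hH, radius_sq]
      rw [this]
      exact contDiff_ramp.comp (by fun_prop)
    · refine HasCompactSupport.of_support_subset_isCompact
        (isCompact_radius_preimage (isCompact_Icc (a := 0) (b := R))) fun x hx => ?_
      have : x.1 ^ 2 + x.2 ^ 2 < R ^ 2 := hdisk (subset_tsupport _ hx)
      rw [← radius_sq] at this
      exact ⟨radius_nonneg x, (lt_of_pow_lt_pow_left₀ 2 hR.le this).le⟩
  have hE : ∫ x, gradSq (fun y => H (radius y)) x ≤ 2 * π := by
    rw [integral_gradSq_radial (H := H) fun r _ => hder r,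
      setIntegral_Ioi_eq_intervalIntegral (h := fun r => H' r ^ 2) le_rfl hR.le fun r hr hnot => by
        simp only [hH']
        rw [Real.smoothTransition.zero_of_nonpos (by linarith [hsmall r hr hnot])]
        simp]
    have hle : ∫ r in 0..R, r * H' r ^ 2 ≤ ∫ r in 0..R, 4 / R ^ 4 * r ^ 3 := by
      refine intervalIntegral.integral_mono_on hR.le
        (Continuous.intervalIntegrable (by fun_prop) _ _)
        (Continuous.intervalIntegrable (by fun_prop) _ _) fun r hr => ?_
      have hχ : Real.smoothTransition (32 * (1 - r ^ 2 / R ^ 2) - 1) ^ 2 ≤ 1 :=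
        pow_le_one₀ (Real.smoothTransition.nonneg _) (Real.smoothTransition.le_one _)
      have hr0 : 0 ≤ 4 / R ^ 4 * r ^ 3 := by
        have := hr.1
        positivity
      calc r * H' r ^ 2 = Real.smoothTransition (32 * (1 - r ^ 2 / R ^ 2) - 1) ^ 2
            * (4 / R ^ 4 * r ^ 3) := by
            simp only [hH']; field_simp; ring
        _ ≤ 1 * (4 / R ^ 4 * r ^ 3) := mul_le_mul_of_nonneg_right hχ hr0
        _ = _ := one_mul _
    have hval : ∫ r in 0..R, 4 / R ^ 4 * r ^ 3 = 1 := by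
      rw [intervalIntegral.integral_const_mul, integral_pow]
      field_simp
      norm_num
      ring
    nlinarith [Real.pi_pos]
  have hU : 2 * π * (R ^ 2 / 8) < ∫ x, H (radius x) ^ 2 := by
    rw [integral_radial fun r => H r ^ 2,
      setIntegral_Ioi_eq_intervalIntegral (h := fun r => H r ^ 2) le_rfl hR.le fun r hr hnot => by
        simp only [hH]
        rw [ramp_eq_zero (by linarith [hsmall r hr hnot])]
        simp]
    refine mul_lt_mul_of_pos_left ?_ (by positivity)
    set ρ := 24 / 25 * R with hρ
    have hρ0 : 0 ≤ ρ := by positivity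
    have hρR : ρ ≤ R := by linarith
    have h1 : ∫ r in 0..ρ, r * H r ^ 2 ≤ ∫ r in 0..R, r * H r ^ 2 := by
      rw [← intervalIntegral.integral_add_adjacent_intervals (b := ρ) (c := R)
        (Continuous.intervalIntegrable (by fun_prop) _ _)
        (Continuous.intervalIntegrable (by fun_prop) _ _), le_add_iff_nonneg_right]
      exact intervalIntegral.integral_nonneg hρR fun r hr =>
        mul_nonneg (hρ0.trans hr.1) (sq_nonneg _)
    have h2 : ∫ r in 0..ρ, r * (15 / 16 - r ^ 2 / R ^ 2) ^ 2 ≤ ∫ r in 0..ρ, r * H r ^ 2 := by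
      refine intervalIntegral.integral_mono_on hρ0
        (Continuous.intervalIntegrable (by fun_prop) _ _)
        (Continuous.intervalIntegrable (by fun_prop) _ _) fun r hr => ?_
      have hr2 : r ^ 2 / R ^ 2 ≤ 15 / 16 := by
        rw [div_le_iff₀ hR2]
        have : r ^ 2 ≤ ρ ^ 2 := pow_le_pow_left₀ hr.1 hr.2 2
        rw [hρ, mul_pow] at this
        linarith
      have := sub_le_ramp (s := 1 - r ^ 2 / R ^ 2) (by linarith)
      exact mul_le_mul_of_nonneg_left
        (pow_le_pow_left₀ (by linarith) (by simp only [hH]; linarith) 2) hr.1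
    have h3 : ∫ r in 0..ρ, r * (15 / 16 - r ^ 2 / R ^ 2) ^ 2
        = -(R ^ 2 / 6) * (15 / 16 - ρ ^ 2 / R ^ 2) ^ 3
          - -(R ^ 2 / 6) * (15 / 16 - 0 ^ 2 / R ^ 2) ^ 3 := by
      refine intervalIntegral.integral_eq_sub_of_hasDerivAt
        (f := fun r => -(R ^ 2 / 6) * (15 / 16 - r ^ 2 / R ^ 2) ^ 3) (fun r _ => ?_)
        (Continuous.intervalIntegrable (by fun_prop) _ _)
      have hd : HasDerivAt (fun r : ℝ => 15 / 16 - r ^ 2 / R ^ 2) (-(2 * r / R ^ 2)) r := by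
        simpa using ((hasDerivAt_pow 2 r).div_const (R ^ 2)).const_sub (15 / 16)
      refine ((hd.pow 3).const_mul (-(R ^ 2 / 6))).congr_deriv ?_
      have hR0 := hR.ne'
      push_cast
      field_simp
      ring
    have h4 : ρ ^ 2 / R ^ 2 = (24 / 25) ^ 2 := by rw [hρ]; field_simp
    have h5 : (0 : ℝ) ^ 2 / R ^ 2 = 0 := by simp
    rw [h4, h5] at h3
    linarith
  have hne : (fun x => H (radius x)) ≠ 0 := by
    intro h
    have h0 : ∀ x, H (radius x) = 0 := fun x => congrFun h x
    simp only [h0] at hU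
    have : 0 < 2 * π * (R ^ 2 / 8) := by positivity
    simp at hU
    linarith
  refine (dirichletEV_one_le hu hne).trans_lt ?_
  rw [hu.rayleigh_eq, div_lt_iff₀ (hu.integral_sq_pos hne)]
  calc _ ≤ 2 * π := hE
    _ = 8 / R ^ 2 * (2 * π * (R ^ 2 / 8)) := by field_simp
    _ < _ := mul_lt_mul_of_pos_left hU (by positivity)

end FirstEigenvalueDisk

section SecondEigenvalueDisk

variable {R : ℝ}

theorem disk_abs_lt (hR : 0 < R) {x : ℝ × ℝ} (hx : x ∈ disk R) : |x.1| < R ∧ |x.2| < R := by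
  have h : x.1 ^ 2 + x.2 ^ 2 < R ^ 2 := hx
  exact ⟨abs_lt_of_sq_lt_sq (by nlinarith [sq_nonneg x.2]) hR.le,
    abs_lt_of_sq_lt_sq (by nlinarith [sq_nonneg x.1]) hR.le⟩

theorem integral_eq_iterated_of_disk (hR : 0 < R) {F : ℝ × ℝ → ℝ} (hF : Continuous F)
    (hc : HasCompactSupport F) (h0 : ∀ x ∉ disk R, F x = 0) :
    ∫ x, F x = ∫ y in -R..R, ∫ x in -R..R, F (x, y) := by
  have hFint : Integrable F (volume.prod volume) := hF.integrable_of_hasCompactSupport hc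
  rw [show ∫ x, F x = ∫ x, F x ∂(volume.prod volume) from rfl, integral_prod_symm F hFint]
  have hmem : ∀ t : ℝ, |t| < R → t ∈ Ioc (-R) R := fun t ht =>
    ⟨(abs_lt.1 ht).1, (abs_lt.1 ht).2.le⟩
  have hx : ∀ y, ∫ x, F (x, y) = ∫ x in -R..R, F (x, y) := fun y => by
    refine (intervalIntegral.integral_eq_integral_of_support_subset fun x hx => ?_).symm
    by_contra h
    exact hx (h0 _ fun hd => h (hmem _ (disk_abs_lt hR hd).1))
  simp only [hx]
  refine (intervalIntegral.integral_eq_integral_of_support_subset fun y hy => ?_).symm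
  by_contra h
  refine hy ?_
  have : ∀ x, F (x, y) = 0 := fun x => h0 _ fun hd => h (hmem _ (disk_abs_lt hR hd).2)
  simp [this]

theorem continuous_integral_slice {F : ℝ × ℝ → ℝ} (hF : Continuous F) (a b : ℝ) :
    Continuous fun y => ∫ x in a..b, F (x, y) :=
  intervalIntegral.continuous_parametric_intervalIntegral_of_continuous' (by fun_prop) a b

theorem hasDerivAt_slice_fst {u : ℝ × ℝ → ℝ} (hu : Differentiable ℝ u) (x y : ℝ) :
    HasDerivAt (fun s => u (s, y)) (fderiv ℝ u (x, y) (1, 0)) x :=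
  (hu (x, y)).hasFDerivAt.comp_hasDerivAt (f := fun s : ℝ => (s, y)) x
    ((hasDerivAt_id x).prodMk (hasDerivAt_const x y))

theorem hasDerivAt_slice_snd {u : ℝ × ℝ → ℝ} (hu : Differentiable ℝ u) (x y : ℝ) :
    HasDerivAt (fun s => u (x, s)) (fderiv ℝ u (x, y) (0, 1)) y :=
  (hu (x, y)).hasFDerivAt.comp_hasDerivAt (f := fun s : ℝ => (x, s)) y
    ((hasDerivAt_const y x).prodMk (hasDerivAt_id y))

theorem testFun.hasDerivAt_integral_slice {ω : Set (ℝ × ℝ)} {u : ℝ × ℝ → ℝ} (hu : testFun ω u)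
    (a b y : ℝ) :
    HasDerivAt (fun y => ∫ x in a..b, u (x, y)) (∫ x in a..b, fderiv ℝ u (x, y) (0, 1)) y := by
  have hg : Continuous fun p => fderiv ℝ u p (0, 1) :=
    hu.continuous_fderiv.clm_apply continuous_const
  have hgc : HasCompactSupport fun p => fderiv ℝ u p (0, 1) :=
    HasCompactSupport.intro hu.2.1 fun p hp => by
      simp [fderiv_eq_zero_of_notMem_tsupport hp]
  obtain ⟨C, hC⟩ := hgc.exists_bound_of_continuous hg
  have huc := hu.continuous
  refine (intervalIntegral.hasDerivAt_integral_of_dominated_loc_of_deriv_le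
    (F := fun y x => u (x, y)) (F' := fun y x => fderiv ℝ u (x, y) (0, 1)) (bound := fun _ => C)
    (s := univ) Filter.univ_mem
    (Filter.Eventually.of_forall fun z => Continuous.aestronglyMeasurable (by fun_prop))
    (Continuous.intervalIntegrable (by fun_prop) _ _)
    (Continuous.aestronglyMeasurable (hg.comp (by fun_prop : Continuous fun x : ℝ => (x, y))))
    (Filter.Eventually.of_forall fun x _ z _ => hC (x, z))
    intervalIntegrable_const
    (Filter.Eventually.of_forall fun x _ z _ => hasDerivAt_slice_snd hu.differentiable x z)).2

theorem sq_integral_mid_le (hR : 0 < R) {f : ℝ → ℝ} (hf : Continuous f) :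
    (∫ x in -(R / 2)..R / 2, f x) ^ 2 ≤ R * ∫ x in -R..R, f x ^ 2 := by
  have h1 := sq_integral_le hf (a := -(R / 2)) (b := R / 2) (by linarith)
  have h2 : ∫ x in -(R / 2)..R / 2, f x ^ 2 ≤ ∫ x in -R..R, f x ^ 2 :=
    intervalIntegral.integral_mono_interval (by linarith) (by linarith) (by linarith)
      (Filter.Eventually.of_forall fun x => sq_nonneg _) ((hf.pow 2).intervalIntegrable _ _)
  calc _ ≤ _ := h1
    _ = R * ∫ x in -(R / 2)..R / 2, f x ^ 2 := by ring
    _ ≤ _ := mul_le_mul_of_nonneg_left h2 hR.le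

theorem testFun.mul_integral_sq_le_of_mean_eq_zero {u : ℝ × ℝ → ℝ} (hR : 0 < R)
    (hu : testFun (disk R) u)
    (hmean : ∫ y in -(R / 2)..R / 2, ∫ x in -(R / 2)..R / 2, u (x, y) = 0) :
    8 / R ^ 2 * ∫ x, u x ^ 2 ≤ ∫ x, gradSq u x := by
  have huc := hu.continuous
  have hux : Continuous fun p => fderiv ℝ u p (1, 0) :=
    hu.continuous_fderiv.clm_apply continuous_const
  have huy : Continuous fun p => fderiv ℝ u p (0, 1) :=
    hu.continuous_fderiv.clm_apply continuous_const
  have hRle : -R ≤ R := by linarith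
  have hout1 : ∀ x y, |x| = R → u (x, y) = 0 := fun x y h =>
    hu.eq_zero fun hd => (disk_abs_lt hR hd).1.ne h
  have hout2 : ∀ x y, |y| = R → u (x, y) = 0 := fun x y h =>
    hu.eq_zero fun hd => (disk_abs_lt hR hd).2.ne h
  set α : ℝ → ℝ := fun y => ∫ x in -(R / 2)..R / 2, u (x, y) with hα
  set β : ℝ → ℝ := fun y => ∫ x in -(R / 2)..R / 2, fderiv ℝ u (x, y) (0, 1) with hβ
  have hαc : Continuous α := continuous_integral_slice huc _ _
  have hβc : Continuous β := continuous_integral_slice huy _ _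
  have hU : Continuous fun y => ∫ x in -R..R, u (x, y) ^ 2 :=
    continuous_integral_slice (huc.pow 2) _ _
  have hX : Continuous fun y => ∫ x in -R..R, fderiv ℝ u (x, y) (1, 0) ^ 2 :=
    continuous_integral_slice (hux.pow 2) _ _
  have hY : Continuous fun y => ∫ x in -R..R, fderiv ℝ u (x, y) (0, 1) ^ 2 :=
    continuous_integral_slice (huy.pow 2) _ _
  have hαR : Continuous fun y => α y ^ 2 / R := (hαc.pow 2).div_const R
  have hslice : (∫ y in -R..R, ∫ x in -R..R, u (x, y) ^ 2) - (∫ y in -R..R, α y ^ 2) / R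
      ≤ R ^ 2 / 8 * ∫ y in -R..R, ∫ x in -R..R, fderiv ℝ u (x, y) (1, 0) ^ 2 := by
    rw [← intervalIntegral.integral_div, ← intervalIntegral.integral_sub
      (hU.intervalIntegrable _ _) (hαR.intervalIntegrable _ _),
      ← intervalIntegral.integral_const_mul]
    refine intervalIntegral.integral_mono_on hRle
      ((hU.sub hαR).intervalIntegrable _ _)
      ((continuous_const.mul hX).intervalIntegrable _ _) fun y _ => ?_
    exact poincare_with_mean (fun x => hasDerivAt_slice_fst hu.differentiable x y)
      (hux.comp (by fun_prop : Continuous fun x : ℝ => (x, y))) hR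
      (hout1 _ _ (by rw [abs_neg, abs_of_pos hR])) (hout1 _ _ (abs_of_pos hR))
  have hαle : ∫ y in -R..R, α y ^ 2 ≤ R ^ 2 / 8 * ∫ y in -R..R, β y ^ 2 := by
    have := poincare_with_mean (f := α) (fun y => hu.hasDerivAt_integral_slice _ _ y) hβc hR
      (by simp [hα, hout2 _ (-R) (by rw [abs_neg, abs_of_pos hR])])
      (by simp [hα, hout2 _ R (abs_of_pos hR)])
    rw [hmean] at this
    simpa using this
  have hβle : ∫ y in -R..R, β y ^ 2
      ≤ R * ∫ y in -R..R, ∫ x in -R..R, fderiv ℝ u (x, y) (0, 1) ^ 2 := by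
    rw [← intervalIntegral.integral_const_mul]
    exact intervalIntegral.integral_mono_on hRle ((hβc.pow 2).intervalIntegrable _ _)
      ((continuous_const.mul hY).intervalIntegrable _ _) fun y _ =>
      sq_integral_mid_le hR (huy.comp (by fun_prop : Continuous fun x : ℝ => (x, y)))
  have hgrad : ∫ x, gradSq u x = (∫ y in -R..R, ∫ x in -R..R, fderiv ℝ u (x, y) (1, 0) ^ 2)
      + ∫ y in -R..R, ∫ x in -R..R, fderiv ℝ u (x, y) (0, 1) ^ 2 := by
    rw [integral_eq_iterated_of_disk hR hu.continuous_gradSq hu.hasCompactSupport_gradSq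
      fun x hx => hu.gradSq_eq_zero hx, ← intervalIntegral.integral_add
      (hX.intervalIntegrable _ _) (hY.intervalIntegrable _ _)]
    refine intervalIntegral.integral_congr fun y _ => ?_
    exact intervalIntegral.integral_add
      (((hux.pow 2).comp (by fun_prop : Continuous fun x : ℝ => (x, y))).intervalIntegrable _ _)
      (((huy.pow 2).comp (by fun_prop : Continuous fun x : ℝ => (x, y))).intervalIntegrable _ _)
  have hsq : ∫ x, u x ^ 2 = ∫ y in -R..R, ∫ x in -R..R, u (x, y) ^ 2 :=
    integral_eq_iterated_of_disk hR (huc.pow 2) hu.hasCompactSupport_sq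
      fun x hx => by simp [hu.eq_zero hx]
  have hα' : (∫ y in -R..R, α y ^ 2) / R
      ≤ R ^ 2 / 8 * ∫ y in -R..R, ∫ x in -R..R, fderiv ℝ u (x, y) (0, 1) ^ 2 := by
    rw [div_le_iff₀ hR]
    refine hαle.trans ((mul_le_mul_of_nonneg_left hβle (by positivity)).trans_eq (by ring))
  rw [hgrad, hsq, div_mul_eq_mul_div, div_le_iff₀ (by positivity)]
  linarith

theorem le_dirichletEV_disk_two (hR : 0 < R) : 8 / R ^ 2 ≤ dirichletEV (disk R) 2 := by
  refine le_dirichletEV_two (isOpen_disk R) (p := (0, 0)) (q := (R / 2, 0)) ?_ ?_ ?_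
    (fun u => ∫ y in -(R / 2)..R / 2, ∫ x in -(R / 2)..R / 2, u (x, y)) ?_ ?_
    fun u hu h => hu.mul_integral_sq_le_of_mean_eq_zero hR h
  · change (0 : ℝ) ^ 2 + 0 ^ 2 < R ^ 2
    nlinarith
  · change (R / 2) ^ 2 + 0 ^ 2 < R ^ 2
    nlinarith
  · intro h
    have := congrArg Prod.fst h
    simp only at this
    linarith
  · intro u v hu hv
    have hu' := hu.continuous
    have hv' := hv.continuous
    rw [← intervalIntegral.integral_add
      ((continuous_integral_slice hu' _ _).intervalIntegrable _ _)
      ((continuous_integral_slice hv' _ _).intervalIntegrable _ _)]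
    refine intervalIntegral.integral_congr fun y _ => ?_
    exact intervalIntegral.integral_add
      ((hu'.comp (by fun_prop : Continuous fun x : ℝ => (x, y))).intervalIntegrable _ _)
      ((hv'.comp (by fun_prop : Continuous fun x : ℝ => (x, y))).intervalIntegrable _ _)
  · intro a u
    simp [intervalIntegral.integral_const_mul]

end SecondEigenvalueDisk

section Window

/-- A nonincreasing function on `(R₁, ∞)` whose jumps are excluded by a comparison inequality
takes values in `(p, q)` exactly on an open interval, provided that it takes a value at least `q`
and a value at most `p`. -/
theorem exists_Ioo_of_antitone_of_le_mul {f : ℝ → ℝ} {R₁ p q : ℝ}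
    (hanti : ∀ r s, R₁ < r → r ≤ s → f s ≤ f r)
    (hcomp : ∀ r s, R₁ < r → r ≤ s → s - R₁ < 2 * (r - R₁) →
      f r ≤ ((s - R₁) / (r - R₁)) ^ 3 * f s)
    (hpq : p < q) (hq : ∃ r, R₁ < r ∧ q ≤ f r) (hp : ∃ r, R₁ < r ∧ f r ≤ p) :
    ∃ a b, R₁ < a ∧ a < b ∧ ∀ r, R₁ < r → (p < f r ∧ f r < q ↔ r ∈ Ioo a b) := by
  obtain ⟨r₀, hr₀, hqr₀⟩ := hq
  obtain ⟨r₁, hr₁, hpr₁⟩ := hp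
  set S : Set ℝ := {r | R₁ < r ∧ q ≤ f r}
  set T : Set ℝ := {r | R₁ < r ∧ f r ≤ p}
  have hST : ∀ r ∈ S, ∀ s ∈ T, r < s := by
    rintro r ⟨hr, hqr⟩ s ⟨hs, hps⟩
    by_contra h
    linarith [hanti s r hs (not_lt.1 h)]
  have hSne : S.Nonempty := ⟨r₀, hr₀, hqr₀⟩
  have hTne : T.Nonempty := ⟨r₁, hr₁, hpr₁⟩
  have hSb : BddAbove S := ⟨r₁, fun r hr => (hST r hr r₁ ⟨hr₁, hpr₁⟩).le⟩
  have hTb : BddBelow T := ⟨r₀, fun s hs => (hST r₀ ⟨hr₀, hqr₀⟩ s hs).le⟩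
  have ha : R₁ < sSup S := hr₀.trans_le (le_csSup hSb ⟨hr₀, hqr₀⟩)
  have hb : R₁ < sInf T := hr₀.trans_le
    (le_csInf hTne fun s hs => (hST r₀ ⟨hr₀, hqr₀⟩ s hs).le)
  have hqa : q ≤ f (sSup S) := by
    set a := sSup S
    by_contra! h
    have hcont : ContinuousAt (fun r => ((a - R₁) / (r - R₁)) ^ 3 * f a) a :=
      ((continuousAt_const.div (continuousAt_id.sub continuousAt_const)
        (sub_ne_zero.2 ha.ne')).pow 3).mul continuousAt_const
    have hev : ∀ᶠ r in nhds a, ((a - R₁) / (r - R₁)) ^ 3 * f a < q := by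
      refine hcont.eventually_lt_const ?_
      beta_reduce
      rw [div_self (sub_ne_zero.2 ha.ne'), one_pow, one_mul]
      exact h
    have hev2 : ∀ᶠ r in nhds a, R₁ + (a - R₁) / 2 < r := lt_mem_nhds (by linarith)
    obtain ⟨ε, hε, hball⟩ := Metric.eventually_nhds_iff.1 (hev.and hev2)
    obtain ⟨r, hrS, hr⟩ := exists_lt_of_lt_csSup hSne (sub_lt_self a hε)
    have hra : r ≤ a := le_csSup hSb hrS
    obtain ⟨h1, h2⟩ := hball (y := r) (by rw [Real.dist_eq, abs_lt]; constructor <;> linarith)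
    linarith [hcomp r a hrS.1 hra (by linarith), hrS.2]
  have hpb : f (sInf T) ≤ p := by
    set b := sInf T
    by_contra! h
    have hcont : ContinuousAt (fun r => ((r - R₁) / (b - R₁)) ^ 3 * p) b := by fun_prop
    have hev : ∀ᶠ r in nhds b, ((r - R₁) / (b - R₁)) ^ 3 * p < f b := by
      refine hcont.eventually_lt_const ?_
      beta_reduce
      rw [div_self (sub_ne_zero.2 hb.ne'), one_pow, one_mul]
      exact h
    have hev2 : ∀ᶠ r in nhds b, r < R₁ + 2 * (b - R₁) := gt_mem_nhds (by linarith)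
    obtain ⟨ε, hε, hball⟩ := Metric.eventually_nhds_iff.1 (hev.and hev2)
    obtain ⟨r, hrT, hr⟩ := exists_lt_of_csInf_lt hTne (lt_add_of_pos_right b hε)
    have hbr : b ≤ r := csInf_le hTb hrT
    obtain ⟨h1, h2⟩ := hball (y := r) (by rw [Real.dist_eq, abs_lt]; constructor <;> linarith)
    have hpos : 0 ≤ ((r - R₁) / (b - R₁)) ^ 3 :=
      pow_nonneg (div_nonneg (sub_nonneg.2 hrT.1.le) (sub_nonneg.2 hb.le)) 3
    linarith [hcomp b r hb hbr (by linarith), mul_le_mul_of_nonneg_left hrT.2 hpos]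
  refine ⟨sSup S, sInf T, ha, hST _ ⟨ha, hqa⟩ _ ⟨hb, hpb⟩, fun r hr => ⟨fun h => ?_, fun h => ?_⟩⟩
  · constructor
    · by_contra! h'
      linarith [hanti _ _ hr h', h.2]
    · by_contra! h'
      linarith [hanti _ _ hb h', h.1]
  · constructor
    · by_contra! h'
      exact absurd h.2 (not_lt.2 (csInf_le hTb ⟨hr, h'⟩))
    · by_contra! h'
      exact absurd h.1 (not_lt.2 (le_csSup hSb ⟨hr, h'⟩))

end Window

/-- for every `R₁ > 0` there is an interval `(a, b)` with `R₁ < a < b` such that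
`λ₁(B_{R₁}) < λ₁(M_{R₁,R₂}) < λ₂(B_{R₁})` holds if and only if `R₂ ∈ (a, b)`. -/
theorem annulus_spectral_window (R₁ : ℝ) (hR₁ : 0 < R₁) :
    ∃ a b : ℝ, R₁ < a ∧ a < b ∧
      ∀ R₂ : ℝ, R₁ < R₂ →
        ((dirichletEV (disk R₁) 1 < dirichletEV (annulus R₁ R₂) 1 ∧
          dirichletEV (annulus R₁ R₂) 1 < dirichletEV (disk R₁) 2) ↔ R₂ ∈ Set.Ioo a b) := by
  refine exists_Ioo_of_antitone_of_le_mul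
    (fun r s hr hs => dirichletEV_annulus_anti hR₁ hr hs)
    (fun r s hr hs h => dirichletEV_annulus_le_mul hR₁ hr hs h)
    ((dirichletEV_disk_one_lt hR₁).trans_le (le_dirichletEV_disk_two hR₁))
    ?_ ⟨3 * R₁, by linarith, dirichletEV_annulus_le_disk hR₁ le_rfl⟩
  set q := dirichletEV (disk R₁) 2
  have hq : 0 ≤ q := dirichletEV_nonneg _ _
  set l := min R₁ (1 / (q + 1))
  have hl0 : 0 < l := lt_min hR₁ (by positivity)
  refine ⟨R₁ + l, by linarith, le_trans ?_
    (inv_sq_le_dirichletEV_annulus hR₁ (by linarith) (by linarith [min_le_left R₁ (1 / (q + 1))]))⟩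
  have hlq : l * (q + 1) ≤ 1 := (le_div_iff₀ (by positivity)).1 (min_le_right _ _)
  rw [add_sub_cancel_left, ← one_div, le_div_iff₀ (by positivity)]
  have hlq0 : 0 ≤ l * q := by positivity
  nlinarith
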